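/- Fix n ≥ 1 and k with 1 ≤ k ≤ 1+n, and let T be a natural 2-covariant tensor associated to a Lorentzian metric and a k-form on open subsets of ℝ^{1+n}. If T satisfies: (1) independence of the unit of scale, i.e. T(λ²g, λ^{k−1}ω) = T(g,ω) for every λ > 0; (2) for every point x, ω_x = 0 implies T(g,ω)_x = 0; and (3) whenever dω = 0 one has div_g T(g,ω) = − i_{∂_g ω} ω; then T(g,ω) coincides with the energy tensor E(g,ω) := (−1)^{k−1}( ⟨i_−ω, i_−ω⟩_g − (1/2) ⟨ω,ω⟩_g g ). -/

import Mathlib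

namespace Paper

noncomputable section

/-- Points of `ℝ^{1+n}`. -/
abbrev Pt (n : ℕ) := Fin (n + 1) → ℝ

/-- Partial derivative `∂_a f` of a scalar function. -/
def pd (n : ℕ) (a : Fin (n + 1)) (f : Pt n → ℝ) (x : Pt n) : ℝ :=
  fderiv ℝ f x (Pi.single a 1)

/-- The signs `ε₀ = 1`, `ε_i = -1` for `i ≠ 0`. -/
def eps (n : ℕ) (i : Fin (n + 1)) : ℝ := if i = 0 then 1 else -1

/-- The standard Minkowski matrix `diag(1, -1, …, -1)`. -/
def minkM (n : ℕ) (a b : Fin (n + 1)) : ℝ := if a = b then eps n a else 0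

/-- Prepend an entry to an index tuple: `(a, v₁, …, v_{k-1})`. -/
def dcons {α : Type*} (k : ℕ) (a : α) (v : Fin (k - 1) → α) : Fin k → α :=
  fun j => if h : (j : ℕ) = 0 then a else v ⟨(j : ℕ) - 1, by have := j.isLt; omega⟩

/-- Append an entry to an index tuple: `(v₁, …, v_{k-1}, b)`. -/
def dsnoc {α : Type*} (k : ℕ) (v : Fin (k - 1) → α) (b : α) : Fin k → α :=
  fun j => if h : (j : ℕ) < k - 1 then v ⟨(j : ℕ), h⟩ else b

/-- `g` (given by its components) is a Lorentzian metric on the open set `W`: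
it is smooth on `W` and, at each point of `W`, a symmetric bilinear form of
signature `(1,n)` (i.e. congruent to the Minkowski matrix). -/
def IsMetricOn (n : ℕ) (W : Set (Pt n)) (g : Pt n → Fin (n + 1) → Fin (n + 1) → ℝ) : Prop :=
  (∀ a b, ContDiffOn ℝ (⊤ : ℕ∞) (fun x => g x a b) W) ∧
  (∀ x ∈ W, (∀ a b, g x a b = g x b a) ∧
    ∃ P : Matrix (Fin (n + 1)) (Fin (n + 1)) ℝ, IsUnit P.det ∧
      ∀ a b, (∑ c, ∑ d, P c a * g x c d * P d b) = minkM n a b)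

/-- `ω` (given by its components) is a smooth `k`-form field on the open set `W`. -/
def IsFormOn (n k : ℕ) (W : Set (Pt n)) (ω : Pt n → (Fin k → Fin (n + 1)) → ℝ) : Prop :=
  (∀ v, ContDiffOn ℝ (⊤ : ℕ∞) (fun x => ω x v) W) ∧
  (∀ x ∈ W, ∀ (v : Fin k → Fin (n + 1)) (σ : Equiv.Perm (Fin k)),
    ω x (v ∘ σ) = ((Equiv.Perm.sign σ : ℤ) : ℝ) * ω x v)

/-- `t` is a smooth 2-covariant tensor field on `W`. -/
def IsTensorFieldOn (n : ℕ) (W : Set (Pt n)) (t : Pt n → Fin (n + 1) → Fin (n + 1) → ℝ) : Prop :=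
  ∀ a b, ContDiffOn ℝ (⊤ : ℕ∞) (fun x => t x a b) W

/-- `τ : W → W'` is a diffeomorphism between open subsets of `ℝ^{1+n}`, with inverse `σf`. -/
structure IsDiffeoOn (n : ℕ) (τ σf : Pt n → Pt n) (W W' : Set (Pt n)) : Prop where
  open_src : IsOpen W
  open_tgt : IsOpen W'
  mapsTo : Set.MapsTo τ W W'
  mapsTo_inv : Set.MapsTo σf W' W
  left_inv : ∀ x ∈ W, σf (τ x) = x
  right_inv : ∀ y ∈ W', τ (σf y) = y
  smooth : ContDiffOn ℝ (⊤ : ℕ∞) τ W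
  smooth_inv : ContDiffOn ℝ (⊤ : ℕ∞) σf W'

/-- The Jacobian matrix `(dτ_x)(e_a)_c` of a map `τ`. -/
def jac (n : ℕ) (τ : Pt n → Pt n) (x : Pt n) (a c : Fin (n + 1)) : ℝ :=
  fderiv ℝ τ x (Pi.single a 1) c

/-- Pullback of a 2-covariant tensor field (in particular of a metric):
`(τ*g)_x(u,v) = g_{τ(x)}(dτ_x u, dτ_x v)`, componentwise. -/
def pullTensor (n : ℕ) (τ : Pt n → Pt n) (g : Pt n → Fin (n + 1) → Fin (n + 1) → ℝ) :
    Pt n → Fin (n + 1) → Fin (n + 1) → ℝ :=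
  fun x a b => ∑ c, ∑ d, jac n τ x a c * jac n τ x b d * g (τ x) c d

/-- Pullback of a `k`-form field, componentwise. -/
def pullForm (n k : ℕ) (τ : Pt n → Pt n) (ω : Pt n → (Fin k → Fin (n + 1)) → ℝ) :
    Pt n → (Fin k → Fin (n + 1)) → ℝ :=
  fun x v => ∑ w : Fin k → Fin (n + 1), (∏ j, jac n τ x (v j) (w j)) * ω (τ x) w

/-- A natural 2-covariant tensor `T(g,ω)` associated to a Lorentzian metric and a `k`-form
on open subsets of `ℝ^{1+n}`: a rule assigning to every open `W` and every pair `(g,ω)` on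
`W` a 2-covariant tensor field `T(g,ω)` on `W` that commutes with restrictions, is
equivariant under diffeomorphisms between open subsets, and is regular (smooth families of
data yield smooth families of values). -/
structure NaturalTensor (n k : ℕ) where
  T : Set (Pt n) → (Pt n → Fin (n + 1) → Fin (n + 1) → ℝ) →
      (Pt n → (Fin k → Fin (n + 1)) → ℝ) → (Pt n → Fin (n + 1) → Fin (n + 1) → ℝ)
  smooth : ∀ W g ω, IsOpen W → IsMetricOn n W g → IsFormOn n k W ω →
      IsTensorFieldOn n W (T W g ω)
  localize : ∀ W₁ W₂ g₁ ω₁ g₂ ω₂, IsOpen W₁ → IsOpen W₂ → W₁ ⊆ W₂ →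
      IsMetricOn n W₁ g₁ → IsFormOn n k W₁ ω₁ →
      IsMetricOn n W₂ g₂ → IsFormOn n k W₂ ω₂ →
      (∀ x ∈ W₁, g₁ x = g₂ x ∧ ω₁ x = ω₂ x) →
      ∀ x ∈ W₁, T W₁ g₁ ω₁ x = T W₂ g₂ ω₂ x
  natural : ∀ τ σf W W', IsDiffeoOn n τ σf W W' →
      ∀ g ω, IsMetricOn n W' g → IsFormOn n k W' ω →
      ∀ x ∈ W, ∀ a b, T W (pullTensor n τ g) (pullForm n k τ ω) x a b =
        pullTensor n τ (T W' g ω) x a b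
  regular : ∀ (m : ℕ) (P : Set (Fin m → ℝ)) (W : Set (Pt n)), IsOpen P → IsOpen W →
      ∀ (g : (Fin m → ℝ) → Pt n → Fin (n + 1) → Fin (n + 1) → ℝ)
        (ω : (Fin m → ℝ) → Pt n → (Fin k → Fin (n + 1)) → ℝ),
      (∀ a b, ContDiffOn ℝ (⊤ : ℕ∞)
        (fun p : (Fin m → ℝ) × Pt n => g p.1 p.2 a b) (P ×ˢ W)) →
      (∀ v, ContDiffOn ℝ (⊤ : ℕ∞)
        (fun p : (Fin m → ℝ) × Pt n => ω p.1 p.2 v) (P ×ˢ W)) →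
      (∀ s ∈ P, IsMetricOn n W (g s) ∧ IsFormOn n k W (ω s)) →
      ∀ a b, ContDiffOn ℝ (⊤ : ℕ∞)
        (fun p : (Fin m → ℝ) × Pt n => T W (g p.1) (ω p.1) p.2 a b) (P ×ˢ W)

/-- The inverse metric `g^{ab}` at a point. -/
def ginv (n : ℕ) (g : Pt n → Fin (n + 1) → Fin (n + 1) → ℝ) (x : Pt n) :
    Matrix (Fin (n + 1)) (Fin (n + 1)) ℝ :=
  (Matrix.of fun a b => g x a b)⁻¹

/-- The Christoffel symbols
`Γ^c_{ab} = (1/2) g^{cd}(∂_a g_{db} + ∂_b g_{da} − ∂_d g_{ab})`. -/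
def christoffel (n : ℕ) (g : Pt n → Fin (n + 1) → Fin (n + 1) → ℝ) (x : Pt n)
    (c a b : Fin (n + 1)) : ℝ :=
  (1 / 2) * ∑ d, ginv n g x c d *
    (pd n a (fun y => g y d b) x + pd n b (fun y => g y d a) x - pd n d (fun y => g y a b) x)

/-- The divergence of a 2-covariant tensor field: `(div_g t)_b = g^{ac} ∇_a t_{cb}`. -/
def divT (n : ℕ) (g t : Pt n → Fin (n + 1) → Fin (n + 1) → ℝ) (x : Pt n)
    (b : Fin (n + 1)) : ℝ :=
  ∑ a, ∑ c, ginv n g x a c *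
    (pd n a (fun y => t y c b) x - (∑ e, christoffel n g x e a c * t x e b)
      - (∑ e, christoffel n g x e a b * t x c e))

/-- The covariant derivative `∇_a ω_{v₁…v_k}` of a `k`-form field. -/
def covd (n k : ℕ) (g : Pt n → Fin (n + 1) → Fin (n + 1) → ℝ)
    (ω : Pt n → (Fin k → Fin (n + 1)) → ℝ) (x : Pt n) (a : Fin (n + 1))
    (v : Fin k → Fin (n + 1)) : ℝ :=
  pd n a (fun y => ω y v) x -
    ∑ l : Fin k, ∑ e, christoffel n g x e a (v l) * ω x (Function.update v l e)

/-- The codifferential `(∂_g ω)_{i₁…i_{k−1}} = −g^{ab} ∇_a ω_{b i₁…i_{k−1}}`. -/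
def codiff (n k : ℕ) (g : Pt n → Fin (n + 1) → Fin (n + 1) → ℝ)
    (ω : Pt n → (Fin k → Fin (n + 1)) → ℝ) (x : Pt n)
    (v : Fin (k - 1) → Fin (n + 1)) : ℝ :=
  -∑ a, ∑ b, ginv n g x a b * covd n k g ω x a (dcons k b v)

/-- The exterior differential `(dω)_{i₀…i_k} = Σ_j (−1)^j ∂_{i_j} ω_{i₀…î_j…i_k}`. -/
def dext (n k : ℕ) (ω : Pt n → (Fin k → Fin (n + 1)) → ℝ) (x : Pt n)
    (u : Fin (k + 1) → Fin (n + 1)) : ℝ :=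
  ∑ j : Fin (k + 1), (-1 : ℝ) ^ (j : ℕ) * pd n (u j) (fun y => ω y (u ∘ j.succAbove)) x

/-- `(i_{∂_g ω} ω)_b = (1/(k−1)!) (∂_g ω)^{i₂…i_k} ω_{i₂…i_k b}`, indices raised with `g`. -/
def iCodiff (n k : ℕ) (g : Pt n → Fin (n + 1) → Fin (n + 1) → ℝ)
    (ω : Pt n → (Fin k → Fin (n + 1)) → ℝ) (x : Pt n) (b : Fin (n + 1)) : ℝ :=
  (1 / ((k - 1).factorial : ℝ)) *
    ∑ v : Fin (k - 1) → Fin (n + 1), ∑ w : Fin (k - 1) → Fin (n + 1),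
      (∏ j, ginv n g x (v j) (w j)) * codiff n k g ω x v * ω x (dsnoc k w b)

/-- The scalar product `⟨ω,ω⟩_g = (1/k!) ω^{i₁…i_k} ω_{i₁…i_k}`, indices raised with `g`. -/
def scalarSq (n k : ℕ) (g : Pt n → Fin (n + 1) → Fin (n + 1) → ℝ)
    (ω : Pt n → (Fin k → Fin (n + 1)) → ℝ) (x : Pt n) : ℝ :=
  (1 / (k.factorial : ℝ)) * ∑ v : Fin k → Fin (n + 1), ∑ w : Fin k → Fin (n + 1),
    (∏ j, ginv n g x (v j) (w j)) * ω x v * ω x w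

/-- The components of the 2-covariant tensor `⟨i_−ω, i_−ω⟩_g`:
`(1/(k−1)!) ω_a{}^{i₂…i_k} ω_{b i₂…i_k}`, indices raised with `g`. -/
def iiInner (n k : ℕ) (g : Pt n → Fin (n + 1) → Fin (n + 1) → ℝ)
    (ω : Pt n → (Fin k → Fin (n + 1)) → ℝ) (x : Pt n) (a b : Fin (n + 1)) : ℝ :=
  (1 / ((k - 1).factorial : ℝ)) *
    ∑ v : Fin (k - 1) → Fin (n + 1), ∑ w : Fin (k - 1) → Fin (n + 1),
      (∏ j, ginv n g x (v j) (w j)) * ω x (dcons k a v) * ω x (dcons k b w)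

/-- The energy tensor `E(g,ω) = (−1)^{k−1}(⟨i_−ω,i_−ω⟩_g − (1/2)⟨ω,ω⟩_g g)`. -/
def energyTensor (n k : ℕ) (g : Pt n → Fin (n + 1) → Fin (n + 1) → ℝ)
    (ω : Pt n → (Fin k → Fin (n + 1)) → ℝ) (x : Pt n) (a b : Fin (n + 1)) : ℝ :=
  (-1 : ℝ) ^ (k - 1) *
    (iiInner n k g ω x a b - (1 / 2) * scalarSq n k g ω x * g x a b)

/-- The Ricci tensor
`Ricci_{ab} = ∂_c Γ^c_{ab} − ∂_a Γ^c_{cb} + Γ^c_{cd} Γ^d_{ab} − Γ^c_{ad} Γ^d_{cb}`. -/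
def ricci (n : ℕ) (g : Pt n → Fin (n + 1) → Fin (n + 1) → ℝ) (x : Pt n)
    (a b : Fin (n + 1)) : ℝ :=
  (∑ c, pd n c (fun y => christoffel n g y c a b) x)
  - (∑ c, pd n a (fun y => christoffel n g y c c b) x)
  + (∑ c, ∑ d, christoffel n g x c c d * christoffel n g x d a b)
  - (∑ c, ∑ d, christoffel n g x c a d * christoffel n g x d c b)

/-- The scalar curvature `r(g) = g^{ab} Ricci_{ab}`. -/
def scalarCurv (n : ℕ) (g : Pt n → Fin (n + 1) → Fin (n + 1) → ℝ) (x : Pt n) : ℝ :=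
  ∑ a, ∑ b, ginv n g x a b * ricci n g x a b

end

end Paper

namespace Paper

section Characterization

open scoped Topology

theorem contDiff_nat_parametric_integral {E : Type} [NormedAddCommGroup E] [NormedSpace ℝ E]
    [FiniteDimensional ℝ E] (m : ℕ) :
    ∀ {F : Type} [NormedAddCommGroup F] [NormedSpace ℝ F] [CompleteSpace F] (f : E × ℝ → F),
      ContDiff ℝ (⊤ : ℕ∞) f → ContDiff ℝ m (fun x => ∫ t in (0 : ℝ)..1, f (x, t)) := by
  induction m with
  | zero =>
    intro F _ _ _ f hf
    have h : Continuous (Function.uncurry fun (x : E) (t : ℝ) => f (x, t)) := hf.continuous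
    exact contDiff_zero.2
      (intervalIntegral.continuous_parametric_intervalIntegral_of_continuous' h 0 1)
  | succ m ih =>
    intro F _ _ _ f hf
    have hd : Differentiable ℝ f := hf.differentiable (by simp)
    have hf' : ContDiff ℝ (⊤ : ℕ∞)
        (fun p : E × ℝ => (fderiv ℝ f p).comp (ContinuousLinearMap.inl ℝ E ℝ)) :=
      (hf.fderiv_right (m := (⊤ : ℕ∞)) (by simp)).clm_comp contDiff_const
    refine contDiff_succ_iff_hasFDerivAt.2
      ⟨fun x => ∫ t in (0 : ℝ)..1, (fderiv ℝ f (x, t)).comp (ContinuousLinearMap.inl ℝ E ℝ),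
        ih _ hf', fun x₀ => ?_⟩
    obtain ⟨C, hC⟩ := ((isCompact_closedBall x₀ 1).prod (isCompact_Icc (a := (0 : ℝ)) (b := 1))
      ).exists_bound_of_continuousOn hf'.continuous.continuousOn
    refine intervalIntegral.hasFDerivAt_integral_of_dominated_of_fderiv_le
      (F := fun x t => f (x, t))
      (F' := fun x t => (fderiv ℝ f (x, t)).comp (ContinuousLinearMap.inl ℝ E ℝ))
      (bound := fun _ => C)
      (Metric.closedBall_mem_nhds x₀ one_pos) ?_ ?_ ?_ ?_ ?_ ?_
    · exact Filter.Eventually.of_forall fun x =>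
        (hf.continuous.comp (by fun_prop : Continuous fun t : ℝ => (x, t))).aestronglyMeasurable
    · exact (hf.continuous.comp
        (by fun_prop : Continuous fun t : ℝ => (x₀, t))).intervalIntegrable _ _
    · exact (hf'.continuous.comp
        (by fun_prop : Continuous fun t : ℝ => (x₀, t))).aestronglyMeasurable
    · refine Filter.Eventually.of_forall fun t ht x hx => hC (x, t) ⟨hx, ?_⟩
      rw [Set.uIoc_of_le zero_le_one] at ht
      exact ⟨ht.1.le, ht.2⟩
    · exact intervalIntegrable_const
    · refine Filter.Eventually.of_forall fun t _ x _ => ?_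
      exact (hd (x, t)).hasFDerivAt.comp x (hasFDerivAt_prodMk_left x t)

theorem contDiff_parametric_integral {E F : Type} [NormedAddCommGroup E] [NormedSpace ℝ E]
    [FiniteDimensional ℝ E] [NormedAddCommGroup F] [NormedSpace ℝ F] [CompleteSpace F]
    {f : E × ℝ → F} (hf : ContDiff ℝ (⊤ : ℕ∞) f) :
    ContDiff ℝ (⊤ : ℕ∞) (fun x => ∫ t in (0 : ℝ)..1, f (x, t)) :=
  contDiff_infty.2 fun m => contDiff_nat_parametric_integral m f hf

/-- The smooth extension to `s = 0` of the difference quotient `(f (s • x) - f 0) / s`. -/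
noncomputable def rayQuotient {E : Type} [NormedAddCommGroup E] [NormedSpace ℝ E] (f : E → ℝ)
    (s : ℝ) (x : E) : ℝ :=
  ∫ t in (0 : ℝ)..1, fderiv ℝ f ((t * s) • x) x

section rayQuotient

variable {E : Type} [NormedAddCommGroup E] [NormedSpace ℝ E] {f : E → ℝ}

theorem contDiff_rayQuotient [FiniteDimensional ℝ E] (hf : ContDiff ℝ (⊤ : ℕ∞) f) :
    ContDiff ℝ (⊤ : ℕ∞) (fun p : ℝ × E => rayQuotient f p.1 p.2) := by
  have h : ContDiff ℝ (⊤ : ℕ∞)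
      (fun p : (ℝ × E) × ℝ => fderiv ℝ f ((p.2 * p.1.1) • p.1.2) p.1.2) := by
    refine ContDiff.clm_apply ?_ (by fun_prop)
    exact (hf.fderiv_right (m := (⊤ : ℕ∞)) (by simp)).comp (by fun_prop)
  exact contDiff_parametric_integral h

theorem mul_rayQuotient (hf : ContDiff ℝ (⊤ : ℕ∞) f) (s : ℝ) (x : E) :
    s * rayQuotient f s x = f (s • x) - f 0 := by
  have hc : Continuous (fderiv ℝ f) := hf.continuous_fderiv (by simp)
  have h : ∀ t ∈ Set.uIcc (0 : ℝ) 1,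
      HasDerivAt (fun t : ℝ => f ((t * s) • x)) (s * fderiv ℝ f ((t * s) • x) x) t := by
    intro t _
    have h1 : HasDerivAt (fun t : ℝ => (t * s) • x) (s • x) t := by
      simpa using ((hasDerivAt_id t).mul_const s).smul_const x
    have h2 := ((hf.differentiable (by simp)) ((t * s) • x)).hasFDerivAt.comp_hasDerivAt t h1
    simpa [Function.comp_def] using h2
  have h3 := intervalIntegral.integral_eq_sub_of_hasDerivAt h
    ((by fun_prop : Continuous fun t : ℝ => s * fderiv ℝ f ((t * s) • x) x).intervalIntegrable _ _)
  rw [intervalIntegral.integral_const_mul] at h3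
  simpa [rayQuotient] using h3

theorem rayQuotient_zero_left (x : E) : rayQuotient f 0 x = fderiv ℝ f 0 x := by
  simp [rayQuotient]

theorem rayQuotient_smul (r s : ℝ) (x : E) :
    rayQuotient f s (r • x) = r * rayQuotient f (r * s) x := by
  simp only [rayQuotient, ← intervalIntegral.integral_const_mul]
  refine intervalIntegral.integral_congr fun t _ => ?_
  simp [smul_smul, mul_comm, mul_left_comm]

end rayQuotient

/-- A function which is smooth at the origin and homogeneous of degree two is a quadratic form. -/
theorem exists_bilin_of_homogeneous {E : Type} [NormedAddCommGroup E] [NormedSpace ℝ E]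
    {f : E → ℝ} (hf : ContDiffAt ℝ (⊤ : ℕ∞) f 0)
    (hom : ∀ᶠ y in 𝓝 (0 : E), ∀ r : ℝ, 0 < r → r ≤ 1 → f (r • y) = r ^ 2 * f y) :
    ∃ B : E →L[ℝ] E →L[ℝ] ℝ, ∀ᶠ y in 𝓝 (0 : E), f y = B y y := by
  obtain ⟨ε, hε, hball⟩ := Metric.eventually_nhds_iff_ball.1
    ((hf.of_le (m := 2) (WithTop.coe_le_coe.2 (le_top : (2 : ℕ∞) ≤ ⊤))).eventually (by simp) |>.and hom)
  have hdiff : ∀ y ∈ Metric.ball (0 : E) ε, DifferentiableAt ℝ f y := fun y hy =>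
    (hball y hy).1.differentiableAt (by simp)
  have hsmul : ∀ y ∈ Metric.ball (0 : E) ε, ∀ r : ℝ, 0 < r → r ≤ 1 →
      r • y ∈ Metric.ball (0 : E) ε := by
    intro y hy r hr hr1
    rw [mem_ball_zero_iff] at hy ⊢
    rw [norm_smul, Real.norm_of_nonneg hr.le]
    exact (mul_le_of_le_one_left (norm_nonneg y) hr1).trans_lt hy
  have hfd : ∀ y ∈ Metric.ball (0 : E) ε, ∀ r : ℝ, 0 < r → r ≤ 1 →
      fderiv ℝ f (r • y) = r • fderiv ℝ f y := by
    intro y hy r hr hr1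
    have h1 : HasFDerivAt (fun z => f (r • z)) (r • fderiv ℝ f (r • y)) y := by
      have := (hdiff _ (hsmul y hy r hr hr1)).hasFDerivAt.comp y
        ((hasFDerivAt_id y).const_smul r)
      have h : (fderiv ℝ f (r • y)).comp (r • ContinuousLinearMap.id ℝ E)
          = r • fderiv ℝ f (r • y) := by
        ext v
        simp
      rwa [h] at this
    have h2 : HasFDerivAt (fun z => f (r • z)) (r ^ 2 • fderiv ℝ f y) y :=
      ((hdiff y hy).hasFDerivAt.const_smul (r ^ 2)).congr_of_eventuallyEq <| by
        filter_upwards [Metric.isOpen_ball.mem_nhds hy] with z hz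
        simpa using (hball z hz).2 r hr hr1
    have h3 := h1.unique h2
    rw [pow_two, mul_smul] at h3
    exact smul_right_injective _ hr.ne' h3
  have h0 : (0 : E) ∈ Metric.ball (0 : E) ε := Metric.mem_ball_self hε
  have hfd0 : fderiv ℝ f 0 = 0 := by
    have h := hfd 0 h0 (1 / 2) (by norm_num) (by norm_num)
    rw [smul_zero] at h
    have h' : (1 / 2 : ℝ) • fderiv ℝ f 0 = 0 := by
      calc (1 / 2 : ℝ) • fderiv ℝ f 0 = fderiv ℝ f 0 - (1 / 2 : ℝ) • fderiv ℝ f 0 := by module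
        _ = 0 := sub_eq_zero.2 h
    simpa using h'
  have hL : HasFDerivAt (fderiv ℝ f) (fderiv ℝ (fderiv ℝ f) 0) 0 :=
    (((hball 0 h0).1.fderiv_right (m := 1) (by norm_num)).differentiableAt (by simp)).hasFDerivAt
  refine ⟨(1 / 2 : ℝ) • fderiv ℝ (fderiv ℝ f) 0, ?_⟩
  filter_upwards [Metric.ball_mem_nhds (0 : E) hε] with y hy
  have hlin : fderiv ℝ (fderiv ℝ f) 0 y = fderiv ℝ f y := by
    have h1 : HasDerivWithinAt (fun r : ℝ => fderiv ℝ f (r • y))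
        (fderiv ℝ (fderiv ℝ f) 0 y) (Set.Ici 0) 0 := by
      have hline : HasDerivAt (fun r : ℝ => r • y) y 0 := by
        simpa using (hasDerivAt_id (0 : ℝ)).smul_const y
      rw [← zero_smul ℝ y] at hL
      simpa [Function.comp_def] using (hL.comp_hasDerivAt (0 : ℝ) hline).hasDerivWithinAt
    have h2 : HasDerivWithinAt (fun r : ℝ => fderiv ℝ f (r • y)) (fderiv ℝ f y) (Set.Ici 0) 0 := by
      have h3 : HasDerivAt (fun r : ℝ => r • fderiv ℝ f y) (fderiv ℝ f y) 0 := by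
        simpa using (hasDerivAt_id (0 : ℝ)).smul_const (fderiv ℝ f y)
      refine h3.hasDerivWithinAt.congr_of_eventuallyEq ?_ (by simp [hfd0])
      filter_upwards [Icc_mem_nhdsGE (zero_lt_one : (0 : ℝ) < 1)] with r hr
      rcases hr.1.eq_or_lt with h | h
      · simp [← h, hfd0]
      · exact hfd y hy r h hr.2
    exact (uniqueDiffOn_Ici (0 : ℝ) 0 Set.self_mem_Ici).eq_deriv _ h1 h2
  have heuler : fderiv ℝ f y y = 2 * f y := by
    have h1 : HasDerivWithinAt (fun r : ℝ => f (r • y)) (fderiv ℝ f y y) (Set.Iic 1) 1 := by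
      have hline : HasDerivAt (fun r : ℝ => r • y) y 1 := by
        simpa using (hasDerivAt_id (1 : ℝ)).smul_const y
      have h := (hdiff y hy).hasFDerivAt
      rw [← one_smul ℝ y] at h
      simpa [Function.comp_def] using (h.comp_hasDerivAt (1 : ℝ) hline).hasDerivWithinAt
    have h2 : HasDerivWithinAt (fun r : ℝ => f (r • y)) (2 * f y) (Set.Iic 1) 1 := by
      have h3 : HasDerivAt (fun r : ℝ => r ^ 2 * f y) (2 * f y) 1 := by
        simpa using (hasDerivAt_pow 2 (1 : ℝ)).mul_const (f y)
      refine h3.hasDerivWithinAt.congr_of_eventuallyEq ?_ (by simp)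
      filter_upwards [Ioc_mem_nhdsLE (zero_lt_one : (0 : ℝ) < 1)] with r hr
      exact (hball y hy).2 r hr.1 hr.2
    exact (uniqueDiffOn_Iic (1 : ℝ) 1 Set.self_mem_Iic).eq_deriv _ h1 h2
  simp [hlin, heuler]

open scoped MatrixOrder Matrix.Norms.L2Operator in
theorem exists_symm_mul_self {m : ℕ} {C : Matrix (Fin m) (Fin m) ℝ} (hC : C.PosSemidef) :
    ∃ B : Matrix (Fin m) (Fin m) ℝ, B.transpose * B = C := by
  have h0 : 0 ≤ C := Matrix.nonneg_iff_posSemidef.2 hC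
  refine ⟨CFC.sqrt C, ?_⟩
  have h1 : (CFC.sqrt C).PosSemidef := Matrix.nonneg_iff_posSemidef.1 (CFC.sqrt_nonneg C)
  have h2 : (CFC.sqrt C).transpose = CFC.sqrt C := by
    simpa using h1.1.eq
  rw [h2, CFC.sqrt_mul_sqrt_self C h0]

theorem posSemidef_of_near_one {m : ℕ} {C : Matrix (Fin m) (Fin m) ℝ}
    (hs : ∀ i j, C i j = C j i)
    (hC : ∀ i j, |C i j - (1 : Matrix (Fin m) (Fin m) ℝ) i j| ≤ 1 / (m + 1)) :
    C.PosSemidef := by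
  refine Matrix.PosSemidef.of_dotProduct_mulVec_nonneg ?_ fun x => ?_
  · ext i j
    simp [hs j i]
  · have h1 : star x ⬝ᵥ C.mulVec x
        = ∑ i, x i ^ 2 + ∑ i, ∑ j, (C i j - (1 : Matrix (Fin m) (Fin m) ℝ) i j) * (x i * x j) := by
      have h : ∀ i, ∑ j, (C i j - (1 : Matrix (Fin m) (Fin m) ℝ) i j) * (x i * x j)
          = x i * ∑ j, C i j * x j - x i ^ 2 := by
        intro i
        simp only [sub_mul, Finset.sum_sub_distrib, Matrix.one_apply, ite_mul, one_mul, zero_mul,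
          Finset.sum_ite_eq, Finset.mem_univ, if_true, Finset.mul_sum, pow_two]
        congr 1
        exact Finset.sum_congr rfl fun j _ => by ring
      simp only [h, Finset.sum_sub_distrib, add_sub_cancel, dotProduct, Matrix.mulVec,
        star_trivial]
    have h2 : |∑ i, ∑ j, (C i j - (1 : Matrix (Fin m) (Fin m) ℝ) i j) * (x i * x j)|
        ≤ 1 / (m + 1) * (∑ i, |x i|) ^ 2 := by
      rw [pow_two, Finset.sum_mul_sum, Finset.mul_sum]
      refine (Finset.abs_sum_le_sum_abs _ _).trans (Finset.sum_le_sum fun i _ => ?_)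
      rw [Finset.mul_sum]
      refine (Finset.abs_sum_le_sum_abs _ _).trans (Finset.sum_le_sum fun j _ => ?_)
      rw [abs_mul, abs_mul]
      exact mul_le_mul_of_nonneg_right (hC i j) (by positivity)
    have h3 : (∑ i, |x i|) ^ 2 ≤ m * ∑ i, x i ^ 2 := by
      simpa using sq_sum_le_card_mul_sum_sq (s := (Finset.univ : Finset (Fin m)))
        (f := fun i => |x i|)
    have h4 : 0 ≤ ∑ i, x i ^ 2 := Finset.sum_nonneg fun i _ => sq_nonneg _
    have h5 : 1 / ((m : ℝ) + 1) * (∑ i, |x i|) ^ 2 ≤ ∑ i, x i ^ 2 := by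
      rw [one_div, inv_mul_le_iff₀ (by positivity)]
      nlinarith
    rw [h1]
    linarith [neg_abs_le (∑ i, ∑ j, (C i j - (1 : Matrix (Fin m) (Fin m) ℝ) i j) * (x i * x j))]

/-- Being symmetric of signature `(1,n)`, pointwise. -/
def IsLorentz (n : ℕ) (M : Fin (n + 1) → Fin (n + 1) → ℝ) : Prop :=
  (∀ a b, M a b = M b a) ∧
    ∃ P : Matrix (Fin (n + 1)) (Fin (n + 1)) ℝ, IsUnit P.det ∧
      ∀ a b, (∑ c, ∑ d, P c a * M c d * P d b) = minkM n a b

theorem minkM_comm (n : ℕ) (a b : Fin (n + 1)) : minkM n a b = minkM n b a := by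
  unfold minkM
  by_cases h : a = b
  · subst h; rfl
  · rw [if_neg h, if_neg (Ne.symm h)]

theorem eps_mul_self (n : ℕ) (a : Fin (n + 1)) : eps n a * eps n a = 1 := by
  unfold eps; split_ifs <;> norm_num

theorem isLorentz_minkM (n : ℕ) : IsLorentz n (minkM n) :=
  ⟨minkM_comm n, 1, by simp, fun a b => by simp [Matrix.one_apply]⟩

theorem minkM_eq_diagonal (n : ℕ) : (Matrix.of (minkM n)) = Matrix.diagonal (eps n) := by
  ext a b
  simp [minkM, Matrix.diagonal_apply]

theorem minkM_mul_minkM (n : ℕ) : Matrix.of (minkM n) * Matrix.of (minkM n) = 1 := by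
  rw [minkM_eq_diagonal, Matrix.diagonal_mul_diagonal]
  simp [eps_mul_self]

theorem isLorentz_iff {n : ℕ} {M : Fin (n + 1) → Fin (n + 1) → ℝ} :
    IsLorentz n M ↔ (∀ a b, M a b = M b a) ∧ ∃ P : Matrix (Fin (n + 1)) (Fin (n + 1)) ℝ,
      IsUnit P.det ∧ P.transpose * Matrix.of M * P = Matrix.of (minkM n) := by
  refine and_congr_right fun _ => exists_congr fun P => and_congr_right fun _ => ?_
  rw [← Matrix.ext_iff]
  refine forall_congr' fun a => forall_congr' fun b => ?_
  simp only [Matrix.mul_apply, Matrix.transpose_apply, Matrix.of_apply, Finset.sum_mul]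
  rw [Finset.sum_comm]

theorem eventually_isLorentz (n : ℕ) :
    ∀ᶠ M in 𝓝 (minkM n), (∀ a b, M a b = M b a) → IsLorentz n M := by
  have h00 : minkM n 0 0 = 1 := by simp [minkM, eps]
  have hdet : ∀ᶠ M : Fin (n + 1) → Fin (n + 1) → ℝ in 𝓝 (minkM n), (Matrix.of M).det ≠ 0 := by
    have hc : Continuous fun M : Fin (n + 1) → Fin (n + 1) → ℝ => (Matrix.of M).det :=
      Continuous.matrix_det continuous_id
    refine hc.continuousAt.eventually_ne fun h => ?_
    have := congrArg Matrix.det (minkM_mul_minkM n)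
    simp [h] at this
  have hpos : ∀ᶠ M : Fin (n + 1) → Fin (n + 1) → ℝ in 𝓝 (minkM n), 0 < M 0 0 := by
    have hc : Continuous fun M : Fin (n + 1) → Fin (n + 1) → ℝ => M 0 0 := by fun_prop
    exact hc.continuousAt.eventually_const_lt (by simp [h00])
  have hnear : ∀ i j : Fin n, ∀ᶠ M : Fin (n + 1) → Fin (n + 1) → ℝ in 𝓝 (minkM n),
      |M i.succ 0 * M 0 j.succ / M 0 0 - M i.succ j.succ
        - (1 : Matrix (Fin n) (Fin n) ℝ) i j| < 1 / (n + 1) := by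
    intro i j
    have hc : ContinuousAt (fun M : Fin (n + 1) → Fin (n + 1) → ℝ =>
        |M i.succ 0 * M 0 j.succ / M 0 0 - M i.succ j.succ
          - (1 : Matrix (Fin n) (Fin n) ℝ) i j|) (minkM n) := by
      have : minkM n 0 0 ≠ 0 := by simp [h00]
      refine ContinuousAt.abs (ContinuousAt.sub ?_ continuousAt_const)
      have hev : ∀ a b, ContinuousAt (fun M : Fin (n + 1) → Fin (n + 1) → ℝ => M a b) (minkM n) :=
        fun a b => (continuous_apply_apply a b).continuousAt
      exact (((hev _ _).mul (hev _ _)).div (hev _ _) this).sub (hev _ _)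
    have : |minkM n i.succ 0 * minkM n 0 j.succ / minkM n 0 0 - minkM n i.succ j.succ
          - (1 : Matrix (Fin n) (Fin n) ℝ) i j| = 0 := by
      by_cases hij : i = j
      · subst hij; simp [minkM, eps, Fin.succ_ne_zero]
      · simp [minkM, eps, Fin.succ_ne_zero, hij]
    exact hc.eventually_lt_const (lt_of_eq_of_lt this (by positivity))
  filter_upwards [hdet, hpos, Filter.eventually_all.2 fun i => Filter.eventually_all.2 (hnear i)]
    with M hM hM0 hMn hs
  obtain ⟨B, hB⟩ := exists_symm_mul_self (posSemidef_of_near_one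
    (C := Matrix.of fun i j : Fin n => M i.succ 0 * M 0 j.succ / M 0 0 - M i.succ j.succ)
    (fun i j => by
      simp only [Matrix.of_apply]
      rw [hs i.succ 0, hs 0 j.succ, hs i.succ j.succ]; ring)
    (fun i j => (hMn i j).le))
  have hB' : ∀ i j, ∑ l, B l i * B l j = M i.succ 0 * M 0 j.succ / M 0 0 - M i.succ j.succ := by
    intro i j
    have := congrFun (congrFun hB i) j
    simpa [Matrix.mul_apply] using this
  let S : Matrix (Fin (n + 1)) (Fin (n + 1)) ℝ :=
    Matrix.of (Fin.cons (fun b => M 0 b / √(M 0 0)) fun i => Fin.cons 0 fun j => B i j)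
  have hS : S.transpose * Matrix.of (minkM n) * S = Matrix.of M := by
    have hsq : √(M 0 0) * √(M 0 0) = M 0 0 := Real.mul_self_sqrt hM0.le
    have hne : √(M 0 0) ≠ 0 := (Real.sqrt_pos.2 hM0).ne'
    have hdiv : ∀ p q : ℝ, p / √(M 0 0) * (q / √(M 0 0)) = p * q / M 0 0 := by
      intro p q; rw [div_mul_div_comm, hsq]
    rw [minkM_eq_diagonal]
    ext a b
    rw [Matrix.mul_apply, Fin.sum_univ_succ]
    simp only [Matrix.mul_diagonal, Matrix.transpose_apply, S, Matrix.of_apply, Fin.cons_zero,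
      Fin.cons_succ]
    have e0 : eps n 0 = 1 := by simp [eps]
    have e1 : ∀ i : Fin n, eps n i.succ = -1 := fun i => by simp [eps, Fin.succ_ne_zero]
    simp only [e0, e1, mul_one, hdiv]
    refine Fin.cases ?_ (fun i => ?_) a <;> refine Fin.cases ?_ (fun j => ?_) b
    · simp [hM0.ne']
    · simp; field_simp
    · simp [hs i.succ 0]; field_simp
    · have := hB' i j
      simp only [Fin.cons_succ, mul_neg, mul_one, neg_mul, Finset.sum_neg_distrib, this]
      rw [hs i.succ 0]; ring
  have hSdet : IsUnit S.det := by
    rw [isUnit_iff_ne_zero]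
    intro h
    apply hM
    rw [← hS, Matrix.det_mul, h, mul_zero]
  refine isLorentz_iff.2 ⟨hs, S⁻¹, ?_, ?_⟩
  · rw [Matrix.det_nonsing_inv]
    exact hSdet.ringInverse
  · rw [← hS, Matrix.transpose_nonsing_inv]
    have h1 : S * S⁻¹ = 1 := Matrix.mul_nonsing_inv S hSdet
    have h2 : S.transpose⁻¹ * S.transpose = 1 :=
      Matrix.nonsing_inv_mul _ (by rwa [Matrix.det_transpose])
    calc S.transpose⁻¹ * (S.transpose * Matrix.of (minkM n) * S) * S⁻¹
        = (S.transpose⁻¹ * S.transpose) * Matrix.of (minkM n) * (S * S⁻¹) := by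
          simp only [Matrix.mul_assoc]
      _ = _ := by rw [h1, h2, Matrix.one_mul, Matrix.mul_one]

/-- The `k`-th tensor power of a matrix, acting on index tuples. -/
def tens {ι : Type*} (k : ℕ) (M : Matrix ι ι ℝ) : Matrix (Fin k → ι) (Fin k → ι) ℝ :=
  Matrix.of fun v w => ∏ j, M (v j) (w j)

section tens

variable {ι : Type*} {k : ℕ}

theorem tens_mul [Fintype ι] (M N : Matrix ι ι ℝ) : tens k (M * N) = tens k M * tens k N := by
  ext v w
  simp only [tens, Matrix.of_apply, Matrix.mul_apply, Finset.prod_univ_sum, Fintype.piFinset_univ,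
    Finset.prod_mul_distrib]

theorem tens_diagonal [DecidableEq ι] (d : ι → ℝ) :
    tens k (Matrix.diagonal d) = Matrix.diagonal fun v => ∏ j, d (v j) := by
  ext v w
  by_cases h : v = w
  · subst h; simp [tens]
  · obtain ⟨j, hj⟩ := Function.ne_iff.1 h
    rw [Matrix.diagonal_apply_ne _ h]
    exact Finset.prod_eq_zero (Finset.mem_univ j) (Matrix.diagonal_apply_ne _ hj)

theorem tens_transpose (M : Matrix ι ι ℝ) : tens k M.transpose = (tens k M).transpose := rfl

theorem tens_dotProduct [Fintype ι] [DecidableEq ι] {J G : Matrix ι ι ℝ} (hJ : IsUnit J.det) (A B : (Fin k → ι) → ℝ) :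
    (tens k J).mulVec A ⬝ᵥ (tens k (J * G * J.transpose)⁻¹).mulVec ((tens k J).mulVec B)
      = A ⬝ᵥ (tens k G⁻¹).mulVec B := by
  have h1 : J⁻¹ * J = 1 := Matrix.nonsing_inv_mul J hJ
  have h2 : J.transpose * J.transpose⁻¹ = 1 :=
    Matrix.mul_nonsing_inv _ (by rwa [Matrix.det_transpose])
  rw [Matrix.mulVec_mulVec, Matrix.dotProduct_mulVec, Matrix.dotProduct_mulVec,
    ← Matrix.vecMul_transpose, Matrix.vecMul_vecMul, ← tens_transpose, ← tens_mul, ← tens_mul,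
    Matrix.mul_inv_rev, Matrix.mul_inv_rev]
  congr 3
  calc J.transpose * (J.transpose⁻¹ * (G⁻¹ * J⁻¹) * J)
      = (J.transpose * J.transpose⁻¹) * G⁻¹ * (J⁻¹ * J) := by simp only [Matrix.mul_assoc]
    _ = G⁻¹ := by rw [h1, h2, Matrix.one_mul, Matrix.mul_one]

end tens

/-- Alternation of a covariant tensor given by its components. -/
def IsAlt (n k : ℕ) (A : (Fin k → Fin (n + 1)) → ℝ) : Prop :=
  ∀ (v : Fin k → Fin (n + 1)) (σ : Equiv.Perm (Fin k)),
    A (v ∘ σ) = ((Equiv.Perm.sign σ : ℤ) : ℝ) * A v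

theorem IsAlt.tens_mulVec {n k : ℕ} {A : (Fin k → Fin (n + 1)) → ℝ} (hA : IsAlt n k A)
    (J : Matrix (Fin (n + 1)) (Fin (n + 1)) ℝ) : IsAlt n k ((tens k J).mulVec A) := by
  intro v σ
  simp only [Matrix.mulVec, dotProduct, tens, Matrix.of_apply, Finset.mul_sum]
  rw [← Equiv.sum_comp (Equiv.arrowCongr σ.symm (Equiv.refl (Fin (n + 1))))]
  refine Finset.sum_congr rfl fun w _ => ?_
  have h1 : (Equiv.arrowCongr σ.symm (Equiv.refl (Fin (n + 1)))) w = w ∘ σ := rfl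
  rw [h1, hA w σ, ← mul_assoc, ← mul_assoc, mul_comm _ ((Equiv.Perm.sign σ : ℤ) : ℝ)]
  congr 2
  exact Equiv.prod_comp σ fun j => J (v j) (w j)

theorem pull_eq_mul {n : ℕ} (J : Matrix (Fin (n + 1)) (Fin (n + 1)) ℝ)
    (M : Fin (n + 1) → Fin (n + 1) → ℝ) (a b : Fin (n + 1)) :
    ∑ c, ∑ d, J a c * J b d * M c d = (J * Matrix.of M * J.transpose) a b := by
  simp only [Matrix.mul_apply, Matrix.transpose_apply, Matrix.of_apply, Finset.sum_mul]
  rw [Finset.sum_comm]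
  exact Finset.sum_congr rfl fun c _ => Finset.sum_congr rfl fun d _ => by ring

theorem IsLorentz.pull {n : ℕ} {M : Fin (n + 1) → Fin (n + 1) → ℝ} (hM : IsLorentz n M)
    {J : Matrix (Fin (n + 1)) (Fin (n + 1)) ℝ} (hJ : IsUnit J.det) :
    IsLorentz n fun a b => ∑ c, ∑ d, J a c * J b d * M c d := by
  obtain ⟨hs, P, hP, h⟩ := isLorentz_iff.1 hM
  have hJt : IsUnit J.transpose.det := by rwa [Matrix.det_transpose]
  refine isLorentz_iff.2 ⟨fun a b => ?_, J.transpose⁻¹ * P, ?_, ?_⟩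
  · rw [Finset.sum_comm]
    exact Finset.sum_congr rfl fun c _ => Finset.sum_congr rfl fun d _ => by rw [hs]; ring
  · rw [Matrix.det_mul, Matrix.det_nonsing_inv]
    exact hJt.ringInverse.mul hP
  · have : (Matrix.of fun a b => ∑ c, ∑ d, J a c * J b d * M c d)
        = J * Matrix.of M * J.transpose := by
      ext a b
      exact pull_eq_mul J M a b
    have h1 : J⁻¹ * J = 1 := Matrix.nonsing_inv_mul J hJ
    have h2 : J.transpose * J.transpose⁻¹ = 1 := Matrix.mul_nonsing_inv _ hJt
    rw [this, Matrix.transpose_mul, Matrix.transpose_nonsing_inv, Matrix.transpose_transpose]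
    calc P.transpose * J⁻¹ * (J * Matrix.of M * J.transpose) * (J.transpose⁻¹ * P)
        = P.transpose * (J⁻¹ * J) * Matrix.of M * (J.transpose * J.transpose⁻¹) * P := by
          simp only [Matrix.mul_assoc]
      _ = _ := by rw [h1, h2, Matrix.mul_one, Matrix.mul_one, h]

theorem dcons_succ {α : Type*} (m : ℕ) (a : α) (v : Fin m → α) :
    dcons (m + 1) a v = (Fin.cons a v : Fin (m + 1) → α) := by
  funext j
  refine Fin.cases ?_ (fun i => ?_) j
  · simp [dcons]
  · simp [dcons]

theorem dsnoc_succ {α : Type*} (m : ℕ) (a : α) (v : Fin m → α) :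
    dsnoc (m + 1) v a = (Fin.snoc v a : Fin (m + 1) → α) := by
  funext j
  simp [dsnoc, Fin.snoc]
  rfl

theorem scalarSq_eq {n k : ℕ} (g : Pt n → Fin (n + 1) → Fin (n + 1) → ℝ)
    (ω : Pt n → (Fin k → Fin (n + 1)) → ℝ) (x : Pt n) :
    scalarSq n k g ω x
      = 1 / (k.factorial : ℝ) * (ω x ⬝ᵥ (tens k (Matrix.of (g x))⁻¹).mulVec (ω x)) := by
  simp only [scalarSq, dotProduct, Matrix.mulVec, tens, ginv, Matrix.of_apply, Finset.mul_sum]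
  refine Finset.sum_congr rfl fun v _ => Finset.sum_congr rfl fun w _ => ?_
  show _ * (_ * _ * _) = _ * (_ * (_ * _))
  ring

theorem iiInner_eq {n m : ℕ} (g : Pt n → Fin (n + 1) → Fin (n + 1) → ℝ)
    (ω : Pt n → (Fin (m + 1) → Fin (n + 1)) → ℝ) (x : Pt n) (a b : Fin (n + 1)) :
    iiInner n (m + 1) g ω x a b
      = 1 / (m.factorial : ℝ) * ((fun v : Fin m → Fin (n + 1) => ω x (Fin.cons a v)) ⬝ᵥ
        (tens m (Matrix.of (g x))⁻¹).mulVec fun v => ω x (Fin.cons b v)) := by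
  simp only [iiInner, dotProduct, Matrix.mulVec, tens, ginv, Matrix.of_apply, Finset.mul_sum,
    dcons_succ, Nat.add_sub_cancel]
  refine Finset.sum_congr rfl fun v _ => Finset.sum_congr rfl fun w _ => ?_
  change 1 / (m.factorial : ℝ) * ((∏ j : Fin m, (Matrix.of (g x))⁻¹ (v j) (w j))
    * ω x (Fin.cons a v) * ω x (Fin.cons b w)) = _ * (_ * (_ * _))
  ring

/-- The energy tensor is equivariant under linear changes of frame. -/
theorem energyTensor_pull {n m : ℕ} {g g' : Pt n → Fin (n + 1) → Fin (n + 1) → ℝ}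
    {ω ω' : Pt n → (Fin (m + 1) → Fin (n + 1)) → ℝ} {x y : Pt n}
    {J : Matrix (Fin (n + 1)) (Fin (n + 1)) ℝ} (hJ : IsUnit J.det)
    (hg : ∀ a b, g' y a b = ∑ c, ∑ d, J a c * J b d * g x c d)
    (hω : ∀ v, ω' y v = ∑ w, (∏ j, J (v j) (w j)) * ω x w) (a b : Fin (n + 1)) :
    energyTensor n (m + 1) g' ω' y a b
      = ∑ c, ∑ d, J a c * J b d * energyTensor n (m + 1) g ω x c d := by
  have hG : Matrix.of (g' y) = J * Matrix.of (g x) * J.transpose := by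
    ext a b
    rw [← pull_eq_mul]
    exact hg a b
  have hΩ : ω' y = (tens (m + 1) J).mulVec (ω x) := funext hω
  have hcons : ∀ a, (fun v : Fin m → Fin (n + 1) => ω' y (Fin.cons a v))
      = ∑ c, J a c • (tens m J).mulVec fun v => ω x (Fin.cons c v) := by
    intro a
    funext v
    rw [hω, ← (Fin.consEquiv fun _ => Fin (n + 1)).sum_comp, Fintype.sum_prod_type]
    simp [Fin.consEquiv, Fin.prod_univ_succ, Matrix.mulVec, dotProduct, tens, Finset.mul_sum,
      mul_assoc]
  have hsq : scalarSq n (m + 1) g' ω' y = scalarSq n (m + 1) g ω x := by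
    rw [scalarSq_eq, scalarSq_eq, hG, hΩ, tens_dotProduct hJ]
  have hii : iiInner n (m + 1) g' ω' y a b
      = ∑ c, ∑ d, J a c * J b d * iiInner n (m + 1) g ω x c d := by
    simp only [iiInner_eq, hcons, hG]
    simp only [Matrix.mulVec_sum, sum_dotProduct, dotProduct_sum, Matrix.mulVec_smul,
      smul_dotProduct, dotProduct_smul, tens_dotProduct hJ, smul_eq_mul, Finset.mul_sum]
    rw [Finset.sum_comm]
    exact Finset.sum_congr rfl fun c _ => Finset.sum_congr rfl fun d _ => by ring
  simp only [energyTensor, hii, hsq, hg, Finset.mul_sum, mul_sub, Finset.sum_sub_distrib]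
  congr 1 <;> exact Finset.sum_congr rfl fun c _ => Finset.sum_congr rfl fun d _ => by ring

/-- The sign of a coordinate tuple in Minkowski space. -/
noncomputable def epsProd (n : ℕ) {k : ℕ} (v : Fin k → Fin (n + 1)) : ℝ := ∏ j, eps n (v j)

theorem minkM_inv (n : ℕ) : (Matrix.of (minkM n))⁻¹ = Matrix.of (minkM n) :=
  Matrix.inv_eq_left_inv (minkM_mul_minkM n)

theorem tens_minkM_inv (n k : ℕ) :
    tens k (Matrix.of (minkM n))⁻¹ = Matrix.diagonal fun v => epsProd n v := by
  rw [minkM_inv, minkM_eq_diagonal, tens_diagonal]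
  rfl

/-- The energy tensor of a form with components `A` in Minkowski space. -/
noncomputable def flatEnergy (n m : ℕ) (A : (Fin (m + 1) → Fin (n + 1)) → ℝ)
    (a b : Fin (n + 1)) : ℝ :=
  (-1 : ℝ) ^ m * (1 / (m.factorial : ℝ) *
      (∑ v : Fin m → Fin (n + 1), epsProd n v * (A (Fin.cons a v) * A (Fin.cons b v)))
    - (1 / 2) * (1 / ((m + 1).factorial : ℝ) * ∑ V, epsProd n V * (A V * A V)) * minkM n a b)

theorem energyTensor_flat (n m : ℕ) (ω : Pt n → (Fin (m + 1) → Fin (n + 1)) → ℝ) (x : Pt n)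
    (a b : Fin (n + 1)) :
    energyTensor n (m + 1) (fun _ => minkM n) ω x a b = flatEnergy n m (ω x) a b := by
  simp only [energyTensor, flatEnergy, iiInner_eq, scalarSq_eq, tens_minkM_inv,
    Matrix.mulVec_diagonal, dotProduct, Nat.add_sub_cancel]
  simp only [mul_left_comm]

theorem pd_const (n : ℕ) (a : Fin (n + 1)) (c : ℝ) (x : Pt n) : pd n a (fun _ => c) x = 0 := by
  simp [pd]

theorem christoffel_flat (n : ℕ) (x : Pt n) (c a b : Fin (n + 1)) :
    christoffel n (fun _ => minkM n) x c a b = 0 := by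
  simp [christoffel, pd_const]

theorem ginv_flat (n : ℕ) (x : Pt n) : ginv n (fun _ => minkM n) x = Matrix.diagonal (eps n) := by
  rw [← minkM_eq_diagonal]
  exact minkM_inv n

theorem divT_flat (n : ℕ) (t : Pt n → Fin (n + 1) → Fin (n + 1) → ℝ) (x : Pt n)
    (b : Fin (n + 1)) :
    divT n (fun _ => minkM n) t x b = ∑ a, eps n a * pd n a (fun y => t y a b) x := by
  simp [divT, christoffel_flat, ginv_flat, Matrix.diagonal_apply]

theorem IsAlt.insertNth {n m : ℕ} {A : (Fin (m + 1) → Fin (n + 1)) → ℝ} (hA : IsAlt n (m + 1) A)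
    (i : Fin (m + 1)) (a : Fin (n + 1)) (v : Fin m → Fin (n + 1)) :
    A (i.insertNth a v) = (-1) ^ (i : ℕ) * A (Fin.cons a v) := by
  have h := hA (Fin.cons a v) i.cycleRange
  rw [Fin.cons_comp_cycleRange, Fin.sign_cycleRange] at h
  simpa using h

theorem iCodiff_flat (n m : ℕ) (ω : Pt n → (Fin (m + 1) → Fin (n + 1)) → ℝ) (x : Pt n)
    (hω : IsAlt n (m + 1) (ω x)) (b : Fin (n + 1)) :
    iCodiff n (m + 1) (fun _ => minkM n) ω x b = - ((-1) ^ m * (1 / (m.factorial : ℝ) *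
      ∑ v : Fin m → Fin (n + 1), ∑ a, eps n a * epsProd n v *
        (pd n a (fun y => ω y (Fin.cons a v)) x * ω x (Fin.cons b v)))) := by
  have hsnoc : ∀ v : Fin m → Fin (n + 1),
      ω x (Fin.snoc v b : Fin (m + 1) → Fin (n + 1)) = (-1) ^ m * ω x (Fin.cons b v) := by
    intro v
    rw [← Fin.insertNth_last', hω.insertNth]
    simp
  have hcod : ∀ v : Fin m → Fin (n + 1), codiff n (m + 1) (fun _ => minkM n) ω x v
      = - ∑ a, eps n a * pd n a (fun y => ω y (Fin.cons a v)) x := by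
    intro v
    simp [codiff, covd, christoffel_flat, ginv_flat, Matrix.diagonal_apply, dcons_succ]
  have hprod : ∀ v w : Fin m → Fin (n + 1),
      (∏ j, ginv n (fun _ => minkM n) x (v j) (w j)) = if v = w then epsProd n v else 0 := by
    intro v w
    rw [ginv_flat]
    have := congrFun (congrFun (tens_diagonal (k := m) (eps n)) v) w
    rw [Matrix.diagonal_apply] at this
    exact this
  unfold iCodiff
  simp only [Nat.add_sub_cancel, dsnoc_succ]
  change 1 / (m.factorial : ℝ) * ∑ v : Fin m → Fin (n + 1), ∑ w : Fin m → Fin (n + 1),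
      (∏ j : Fin m, ginv n (fun _ => minkM n) x (v j) (w j))
        * codiff n (m + 1) (fun _ => minkM n) ω x v
        * ω x (Fin.snoc w b : Fin (m + 1) → Fin (n + 1)) = _
  simp only [hprod, hcod, hsnoc, ite_mul, zero_mul, Finset.sum_ite_eq, Finset.mem_univ, if_true]
  simp only [Finset.mul_sum, Finset.sum_mul, ← Finset.sum_neg_distrib]
  refine Finset.sum_congr rfl fun v _ => Finset.sum_congr rfl fun a _ => by ring

/-- Contraction of an alternating tensor with the derivative of a closed form. -/
theorem sum_contract_closed {n m : ℕ} {A : (Fin (m + 1) → Fin (n + 1)) → ℝ}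
    (hA : IsAlt n (m + 1) A) {D : Fin (n + 1) → (Fin (m + 1) → Fin (n + 1)) → ℝ}
    (hD : ∀ u : Fin (m + 2) → Fin (n + 1),
      ∑ j : Fin (m + 2), (-1 : ℝ) ^ (j : ℕ) * D (u j) (u ∘ j.succAbove) = 0)
    (b : Fin (n + 1)) :
    ∑ V, epsProd n V * (A V * D b V) = (m + 1) * ∑ v : Fin m → Fin (n + 1), ∑ a,
      eps n a * epsProd n v * (A (Fin.cons a v) * D a (Fin.cons b v)) := by
  have hDb : ∀ V : Fin (m + 1) → Fin (n + 1), D b V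
      = ∑ i : Fin (m + 1), (-1 : ℝ) ^ (i : ℕ) * D (V i) (Fin.cons b (V ∘ i.succAbove)) := by
    intro V
    have h := hD (Fin.cons b V)
    rw [Fin.sum_univ_succ] at h
    have h0 : (Fin.cons b V : Fin (m + 2) → Fin (n + 1)) ∘ Fin.succAbove 0 = V := by
      funext j; simp
    have hs : ∀ i : Fin (m + 1), (Fin.cons b V : Fin (m + 2) → Fin (n + 1)) ∘ i.succ.succAbove
        = Fin.cons b (V ∘ i.succAbove) := by
      intro i
      funext j
      refine Fin.cases ?_ (fun l => ?_) j <;> simp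
    simp only [h0, hs, Fin.cons_zero, Fin.cons_succ, Fin.val_zero, pow_zero, one_mul, Fin.val_succ,
      pow_succ, mul_neg, mul_one, neg_mul, Finset.sum_neg_distrib] at h
    linarith
  have hi : ∀ i : Fin (m + 1), ∑ V : Fin (m + 1) → Fin (n + 1), epsProd n V * (A V *
      ((-1 : ℝ) ^ (i : ℕ) * D (V i) (Fin.cons b (V ∘ i.succAbove))))
      = ∑ v : Fin m → Fin (n + 1), ∑ a,
        eps n a * epsProd n v * (A (Fin.cons a v) * D a (Fin.cons b v)) := by
    intro i
    rw [← (Fin.insertNthEquiv (fun _ => Fin (n + 1)) i).sum_comp, Fintype.sum_prod_type_right]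
    refine Finset.sum_congr rfl fun v _ => Finset.sum_congr rfl fun a _ => ?_
    have h1 : (i.insertNth a v : Fin (m + 1) → Fin (n + 1)) ∘ i.succAbove = v := by
      funext j; simp
    have h2 : epsProd n (i.insertNth a v : Fin (m + 1) → Fin (n + 1))
        = eps n a * epsProd n v := by
      simp [epsProd, Fin.prod_univ_succAbove _ i]
    have h3 : ((-1 : ℝ) ^ (i : ℕ)) * (-1) ^ (i : ℕ) = 1 := by
      rw [← mul_pow]; simp
    simp only [Fin.insertNthEquiv, Equiv.coe_fn_mk, h1, h2, hA.insertNth, Fin.insertNth_apply_same]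
    linear_combination (eps n a * epsProd n v * (A (Fin.cons a v) * D a (Fin.cons b v))) * h3
  simp only [hDb, Finset.mul_sum]
  rw [Finset.sum_comm]
  simp only [hi, Finset.sum_const, Finset.card_univ, Fintype.card_fin, nsmul_eq_mul, Finset.mul_sum]
  push_cast
  rfl

/-- In Minkowski space the energy tensor of a closed form satisfies the divergence condition. -/
theorem div_flatEnergy {n m : ℕ} {ω : Pt n → (Fin (m + 1) → Fin (n + 1)) → ℝ} {x : Pt n}
    (hd : ∀ v, DifferentiableAt ℝ (fun y => ω y v) x) (hω : IsAlt n (m + 1) (ω x))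
    (hc : ∀ u, dext n (m + 1) ω x u = 0) (b : Fin (n + 1)) :
    ∑ a, eps n a * pd n a (fun y => flatEnergy n m (ω y) a b) x
      = - iCodiff n (m + 1) (fun _ => minkM n) ω x b := by
  have hpd : ∀ a, pd n a (fun y => flatEnergy n m (ω y) a b) x
      = (-1 : ℝ) ^ m * (1 / (m.factorial : ℝ) * (∑ v : Fin m → Fin (n + 1), epsProd n v *
          (ω x (Fin.cons a v) * pd n a (fun y => ω y (Fin.cons b v)) x
            + ω x (Fin.cons b v) * pd n a (fun y => ω y (Fin.cons a v)) x))
        - (1 / 2) * (1 / ((m + 1).factorial : ℝ) * ∑ V, epsProd n V *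
          (ω x V * pd n a (fun y => ω y V) x + ω x V * pd n a (fun y => ω y V) x))
          * minkM n a b) := by
    intro a
    have h := fun v => (hd v).hasFDerivAt
    have h1 := ((HasFDerivAt.fun_sum (u := Finset.univ) fun (v : Fin m → Fin (n + 1)) _ =>
      ((h (Fin.cons a v)).mul (h (Fin.cons b v))).const_mul (epsProd n v)).const_mul
        (1 / (m.factorial : ℝ)))
    have h2 := ((((HasFDerivAt.fun_sum (u := Finset.univ) fun (V : Fin (m + 1) → Fin (n + 1)) _ =>
      ((h V).mul (h V)).const_mul (epsProd n V)).const_mul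
        (1 / ((m + 1).factorial : ℝ))).const_mul (1 / 2)).mul_const (minkM n a b))
    have h3 := ((h1.sub h2).const_mul ((-1 : ℝ) ^ m)).fderiv
    have h4 := congrArg (fun L => L (Pi.single a 1)) h3
    simp only [pd]
    refine Eq.trans h4 ?_
    simp
    ring_nf
  have hkey := sum_contract_closed hω (D := fun a v => pd n a (fun y => ω y v) x) hc b
  have hmink : ∀ (f : Fin (n + 1) → ℝ), ∑ a, eps n a * (f a * minkM n a b) = f b := by
    intro f
    simp only [minkM, mul_ite, mul_zero, Finset.sum_ite_eq', Finset.mem_univ, if_true]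
    linear_combination f b * eps_mul_self n b
  have hS : ∑ a, eps n a * (∑ v : Fin m → Fin (n + 1), epsProd n v *
      (ω x (Fin.cons a v) * pd n a (fun y => ω y (Fin.cons b v)) x
        + ω x (Fin.cons b v) * pd n a (fun y => ω y (Fin.cons a v)) x))
      = (∑ v : Fin m → Fin (n + 1), ∑ a, eps n a * epsProd n v *
          (ω x (Fin.cons a v) * pd n a (fun y => ω y (Fin.cons b v)) x))
        + ∑ v : Fin m → Fin (n + 1), ∑ a, eps n a * epsProd n v *
          (pd n a (fun y => ω y (Fin.cons a v)) x * ω x (Fin.cons b v)) := by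
    simp only [Finset.mul_sum]
    rw [Finset.sum_comm, ← Finset.sum_add_distrib]
    refine Finset.sum_congr rfl fun v _ => ?_
    rw [← Finset.sum_add_distrib]
    exact Finset.sum_congr rfl fun a _ => by ring
  have hK : ∀ a, ∑ V, epsProd n V *
      (ω x V * pd n a (fun y => ω y V) x + ω x V * pd n a (fun y => ω y V) x)
      = 2 * ∑ V, epsProd n V * (ω x V * pd n a (fun y => ω y V) x) := by
    intro a
    rw [Finset.mul_sum]
    exact Finset.sum_congr rfl fun V _ => by ring
  have hfac : ((m + 1).factorial : ℝ) = (m + 1) * m.factorial := by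
    rw [Nat.factorial_succ]
    push_cast
    rfl
  have hm1 : ((m : ℝ) + 1) ≠ 0 := by positivity
  have hm2 : (m.factorial : ℝ) ≠ 0 := by positivity
  have hsum : ∀ S K : Fin (n + 1) → ℝ, ∑ a, eps n a *
      ((-1 : ℝ) ^ m * (1 / (m.factorial : ℝ) * S a - (1 / 2) * K a * minkM n a b))
      = (-1 : ℝ) ^ m * (1 / (m.factorial : ℝ) * (∑ a, eps n a * S a) - (1 / 2) * K b) := by
    intro S K
    rw [← hmink K, Finset.mul_sum, Finset.mul_sum, ← Finset.sum_sub_distrib, Finset.mul_sum]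
    exact Finset.sum_congr rfl fun a _ => by ring
  simp only [hpd]
  rw [hsum _ fun a => 1 / ((m + 1).factorial : ℝ) * ∑ V, epsProd n V *
    (ω x V * pd n a (fun y => ω y V) x + ω x V * pd n a (fun y => ω y V) x), hS, hK, hkey,
    hfac, iCodiff_flat n m ω x hω]
  field_simp
  ring

variable {n k m : ℕ}

theorem IsMetricOn.mono {W W' : Set (Pt n)} {g : Pt n → Fin (n + 1) → Fin (n + 1) → ℝ}
    (hg : IsMetricOn n W g) (h : W' ⊆ W) : IsMetricOn n W' g :=
  ⟨fun a b => (hg.1 a b).mono h, fun x hx => hg.2 x (h hx)⟩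

theorem IsFormOn.mono {W W' : Set (Pt n)} {ω : Pt n → (Fin k → Fin (n + 1)) → ℝ}
    (hω : IsFormOn n k W ω) (h : W' ⊆ W) : IsFormOn n k W' ω :=
  ⟨fun v => (hω.1 v).mono h, fun x hx => hω.2 x (h hx)⟩

theorem IsDiffeoOn.restrict {τ σf : Pt n → Pt n} {U U' W : Set (Pt n)}
    (h : IsDiffeoOn n τ σf U U') (hW : IsOpen W) :
    IsDiffeoOn n τ σf (U ∩ τ ⁻¹' W) (U' ∩ W) where
  open_src := h.smooth.continuousOn.isOpen_inter_preimage h.open_src hW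
  open_tgt := h.open_tgt.inter hW
  mapsTo := fun x hx => ⟨h.mapsTo hx.1, hx.2⟩
  mapsTo_inv := fun y hy => ⟨h.mapsTo_inv hy.1, by
    rw [Set.mem_preimage, h.right_inv y hy.1]; exact hy.2⟩
  left_inv := fun x hx => h.left_inv x hx.1
  right_inv := fun y hy => h.right_inv y hy.1
  smooth := h.smooth.mono Set.inter_subset_left
  smooth_inv := h.smooth_inv.mono Set.inter_subset_left

theorem jac_eq_toMatrix (τ : Pt n → Pt n) (x : Pt n) :
    Matrix.of (jac n τ x) = (LinearMap.toMatrix' (fderiv ℝ τ x : Pt n →ₗ[ℝ] Pt n)).transpose := by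
  ext a c
  simp [jac, LinearMap.toMatrix'_apply]

theorem IsDiffeoOn.isUnit_jac {τ σf : Pt n → Pt n} {U U' : Set (Pt n)}
    (h : IsDiffeoOn n τ σf U U') {x : Pt n} (hx : x ∈ U) :
    IsUnit (Matrix.of (jac n τ x)).det := by
  have h1 : DifferentiableAt ℝ τ x :=
    (h.smooth.contDiffAt (h.open_src.mem_nhds hx)).differentiableAt (by simp)
  have h2 : DifferentiableAt ℝ σf (τ x) :=
    (h.smooth_inv.contDiffAt (h.open_tgt.mem_nhds (h.mapsTo hx))).differentiableAt (by simp)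
  have h3 : (fderiv ℝ σf (τ x)).comp (fderiv ℝ τ x) = ContinuousLinearMap.id ℝ (Pt n) := by
    rw [← fderiv_comp x h2 h1, ← fderiv_id (x := x)]
    refine Filter.EventuallyEq.fderiv_eq ?_
    filter_upwards [h.open_src.mem_nhds hx] with y hy
    exact h.left_inv y hy
  have h4 : LinearMap.toMatrix' (fderiv ℝ σf (τ x) : Pt n →ₗ[ℝ] Pt n)
      * LinearMap.toMatrix' (fderiv ℝ τ x : Pt n →ₗ[ℝ] Pt n) = 1 := by
    rw [← LinearMap.toMatrix'_comp, ← LinearMap.toMatrix'_id]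
    congr 1
    exact congrArg (fun L : Pt n →L[ℝ] Pt n => (L : Pt n →ₗ[ℝ] Pt n)) h3
  rw [jac_eq_toMatrix, Matrix.det_transpose]
  exact Matrix.isUnit_det_of_left_inverse h4

theorem IsDiffeoOn.contDiffOn_jac {τ σf : Pt n → Pt n} {U U' : Set (Pt n)}
    (h : IsDiffeoOn n τ σf U U') (a c : Fin (n + 1)) :
    ContDiffOn ℝ (⊤ : ℕ∞) (fun x => jac n τ x a c) U := by
  have h1 : ContDiffOn ℝ (⊤ : ℕ∞) (fun x => fderiv ℝ τ x) U :=
    h.smooth.fderiv_of_isOpen h.open_src (by simp)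
  exact contDiffOn_pi.1 (h1.clm_apply contDiffOn_const) c

theorem IsMetricOn.pull {τ σf : Pt n → Pt n} {U U' : Set (Pt n)} (h : IsDiffeoOn n τ σf U U')
    {g : Pt n → Fin (n + 1) → Fin (n + 1) → ℝ} (hg : IsMetricOn n U' g) :
    IsMetricOn n U (pullTensor n τ g) := by
  refine ⟨fun a b => ?_, fun x hx => ?_⟩
  · refine ContDiffOn.sum fun c _ => ContDiffOn.sum fun d _ => ?_
    exact ((h.contDiffOn_jac a c).mul (h.contDiffOn_jac b d)).mul
      ((hg.1 c d).comp h.smooth h.mapsTo)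
  · exact IsLorentz.pull (hg.2 (τ x) (h.mapsTo hx)) (h.isUnit_jac hx)

theorem IsFormOn.pull {τ σf : Pt n → Pt n} {U U' : Set (Pt n)} (h : IsDiffeoOn n τ σf U U')
    {ω : Pt n → (Fin k → Fin (n + 1)) → ℝ} (hω : IsFormOn n k U' ω) :
    IsFormOn n k U (pullForm n k τ ω) := by
  refine ⟨fun v => ?_, fun x hx => ?_⟩
  · refine ContDiffOn.sum fun w _ => ContDiffOn.mul (contDiffOn_prod fun j _ => ?_) ?_
    · exact h.contDiffOn_jac _ _
    · exact (hω.1 w).comp h.smooth h.mapsTo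
  · exact IsAlt.tens_mulVec (hω.2 (τ x) (h.mapsTo hx)) (Matrix.of (jac n τ x))

namespace NaturalTensor

variable (T : NaturalTensor n k)

/-- The value of a natural tensor at a point depends only on the germs of the data. -/
theorem congr_germ {W₁ W₂ : Set (Pt n)} {g₁ g₂ : Pt n → Fin (n + 1) → Fin (n + 1) → ℝ}
    {ω₁ ω₂ : Pt n → (Fin k → Fin (n + 1)) → ℝ} (hW₁ : IsOpen W₁) (hW₂ : IsOpen W₂)
    (hg₁ : IsMetricOn n W₁ g₁) (hω₁ : IsFormOn n k W₁ ω₁)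
    (hg₂ : IsMetricOn n W₂ g₂) (hω₂ : IsFormOn n k W₂ ω₂) {x : Pt n} (hx₁ : x ∈ W₁) (hx₂ : x ∈ W₂)
    (h : ∀ᶠ y in 𝓝 x, g₁ y = g₂ y ∧ ω₁ y = ω₂ y) :
    T.T W₁ g₁ ω₁ x = T.T W₂ g₂ ω₂ x := by
  obtain ⟨V, hV, hVo, hxV⟩ := eventually_nhds_iff.1 h
  have ho : IsOpen (V ∩ (W₁ ∩ W₂)) := hVo.inter (hW₁.inter hW₂)
  have hs₁ : V ∩ (W₁ ∩ W₂) ⊆ W₁ := fun y hy => hy.2.1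
  have hs₂ : V ∩ (W₁ ∩ W₂) ⊆ W₂ := fun y hy => hy.2.2
  have hx : x ∈ V ∩ (W₁ ∩ W₂) := ⟨hxV, hx₁, hx₂⟩
  rw [← T.localize _ W₁ g₁ ω₁ g₁ ω₁ ho hW₁ hs₁ (hg₁.mono hs₁) (hω₁.mono hs₁) hg₁ hω₁
    (fun _ _ => ⟨rfl, rfl⟩) x hx]
  exact T.localize _ W₂ g₁ ω₁ g₂ ω₂ ho hW₂ hs₂ (hg₁.mono hs₁) (hω₁.mono hs₁) hg₂ hω₂
    (fun y hy => hV y hy.1) x hx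

/-- Naturality at the level of germs. -/
theorem natural_germ {τ σf : Pt n → Pt n} {U U' W₁ W₂ : Set (Pt n)}
    (hτ : IsDiffeoOn n τ σf U U') {g₁ g₂ : Pt n → Fin (n + 1) → Fin (n + 1) → ℝ}
    {ω₁ ω₂ : Pt n → (Fin k → Fin (n + 1)) → ℝ} (hW₁ : IsOpen W₁) (hW₂ : IsOpen W₂)
    (hg₁ : IsMetricOn n W₁ g₁) (hω₁ : IsFormOn n k W₁ ω₁)
    (hg₂ : IsMetricOn n W₂ g₂) (hω₂ : IsFormOn n k W₂ ω₂) {x : Pt n} (hx : x ∈ U) (hx₁ : x ∈ W₁)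
    (hx₂ : τ x ∈ W₂)
    (h : ∀ᶠ y in 𝓝 x, g₁ y = pullTensor n τ g₂ y ∧ ω₁ y = pullForm n k τ ω₂ y)
    (a b : Fin (n + 1)) :
    T.T W₁ g₁ ω₁ x a b = pullTensor n τ (T.T W₂ g₂ ω₂) x a b := by
  have hτ' := hτ.restrict hW₂
  have hs : U' ∩ W₂ ⊆ W₂ := Set.inter_subset_right
  have hxm : x ∈ U ∩ τ ⁻¹' W₂ := ⟨hx, hx₂⟩
  rw [T.congr_germ hW₁ hτ'.open_src hg₁ hω₁ ((hg₂.mono hs).pull hτ') ((hω₂.mono hs).pull hτ')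
    hx₁ hxm h, T.natural τ σf _ _ hτ' g₂ ω₂ (hg₂.mono hs) (hω₂.mono hs) x hxm a b]
  simp only [pullTensor]
  rw [T.congr_germ hτ'.open_tgt hW₂ (hg₂.mono hs) (hω₂.mono hs) hg₂ hω₂ (hτ'.mapsTo hxm) hx₂
    (Filter.Eventually.of_forall fun _ => ⟨rfl, rfl⟩)]

end NaturalTensor

/-- An affine isomorphism is a diffeomorphism. -/
theorem isDiffeoOn_affine (p : Pt n) (A : Pt n ≃L[ℝ] Pt n) :
    IsDiffeoOn n (fun y => p + A y) (fun z => A.symm (z - p)) Set.univ Set.univ where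
  open_src := isOpen_univ
  open_tgt := isOpen_univ
  mapsTo := Set.mapsTo_univ _ _
  mapsTo_inv := Set.mapsTo_univ _ _
  left_inv := fun x _ => by simp
  right_inv := fun y _ => by simp
  smooth := by fun_prop
  smooth_inv := by fun_prop

theorem jac_affine (p : Pt n) (A : Pt n ≃L[ℝ] Pt n) (x : Pt n) (a c : Fin (n + 1)) :
    jac n (fun y => p + A y) x a c = A (Pi.single a 1) c := by
  simp only [jac]
  rw [fderiv_const_add, ContinuousLinearEquiv.fderiv]
  rfl

theorem pullTensor_eq_smul {τ : Pt n → Pt n} {r : Fin (n + 1) → ℝ} {x : Pt n}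
    (h : ∀ a c, jac n τ x a c = if a = c then r a else 0)
    (g : Pt n → Fin (n + 1) → Fin (n + 1) → ℝ) (a b : Fin (n + 1)) :
    pullTensor n τ g x a b = r a * r b * g (τ x) a b := by
  simp [pullTensor, h]

theorem pullForm_eq_smul {τ : Pt n → Pt n} {r : Fin (n + 1) → ℝ} {x : Pt n}
    (h : ∀ a c, jac n τ x a c = if a = c then r a else 0)
    (ω : Pt n → (Fin k → Fin (n + 1)) → ℝ) (v : Fin k → Fin (n + 1)) :
    pullForm n k τ ω x v = (∏ j, r (v j)) * ω (τ x) v := by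
  have : ∀ w : Fin k → Fin (n + 1), (∏ j, jac n τ x (v j) (w j))
      = if v = w then ∏ j, r (v j) else 0 := by
    intro w
    have h1 := congrFun (congrFun (tens_diagonal (k := k) r) v) w
    rw [Matrix.diagonal_apply] at h1
    simpa [tens, h, Matrix.diagonal_apply] using h1
  simp [pullForm, this]

/-- Behaviour of a scale invariant natural tensor under dilations at the origin. -/
theorem NaturalTensor.dilate (T : NaturalTensor n k) (hk : 1 ≤ k)
    (scale : ∀ W g ω, IsOpen W → IsMetricOn n W g → IsFormOn n k W ω →
      ∀ lam : ℝ, 0 < lam → ∀ x ∈ W, ∀ a b,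
        T.T W (fun y c d => lam ^ 2 * g y c d) (fun y v => lam ^ (k - 1) * ω y v) x a b
          = T.T W g ω x a b)
    {W₁ W₂ : Set (Pt n)} {g₁ g₂ : Pt n → Fin (n + 1) → Fin (n + 1) → ℝ}
    {ω₁ ω₂ : Pt n → (Fin k → Fin (n + 1)) → ℝ} (hW₁ : IsOpen W₁) (hW₂ : IsOpen W₂)
    (hg₁ : IsMetricOn n W₁ g₁) (hω₁ : IsFormOn n k W₁ ω₁)
    (hg₂ : IsMetricOn n W₂ g₂) (hω₂ : IsFormOn n k W₂ ω₂) (h₁ : (0 : Pt n) ∈ W₁)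
    (h₂ : (0 : Pt n) ∈ W₂) {r : ℝ} (hr : 0 < r)
    (h : ∀ᶠ y in 𝓝 (0 : Pt n), (∀ a b, g₁ y a b = g₂ (r • y) a b)
      ∧ ∀ v, ω₁ y v = r * ω₂ (r • y) v) (a b : Fin (n + 1)) :
    T.T W₁ g₁ ω₁ 0 a b = r ^ 2 * T.T W₂ g₂ ω₂ 0 a b := by
  set A : Pt n ≃L[ℝ] Pt n := ContinuousLinearEquiv.smulLeft (Units.mk0 r hr.ne') with hA
  have hAy : ∀ y, A y = r • y := fun y => rfl
  have hj : ∀ x a c, jac n (fun y => (0 : Pt n) + A y) x a c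
      = if a = c then (fun _ => r) a else 0 := by
    intro x a c
    rw [jac_affine, hAy]
    simp [Pi.single_apply, eq_comm]
  have hgs : IsMetricOn n W₁ fun y c d => r ^ 2 * g₁ y c d := by
    refine ⟨fun a b => contDiffOn_const.mul (hg₁.1 a b), fun x hx => ?_⟩
    have h3 := IsLorentz.pull (hg₁.2 x hx) (J := r • 1)
      (by rw [Matrix.det_smul, Matrix.det_one, mul_one]; exact (hr.ne'.isUnit).pow _)
    convert h3 using 3
    simp [IsLorentz, Matrix.one_apply, pow_two]
  have hωs : IsFormOn n k W₁ fun y v => r ^ (k - 1) * ω₁ y v :=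
    ⟨fun v => contDiffOn_const.mul (hω₁.1 v), fun x hx v σ => by
      linear_combination r ^ (k - 1) * hω₁.2 x hx v σ⟩
  rw [← scale W₁ g₁ ω₁ hW₁ hg₁ hω₁ r hr 0 h₁ a b,
    T.natural_germ (isDiffeoOn_affine 0 A) hW₁ hW₂ hgs hωs hg₂ hω₂ (Set.mem_univ _) h₁
      (by simpa using h₂) ?_ a b, pullTensor_eq_smul (hj 0)]
  · simp [pow_two]
  · filter_upwards [h] with y hy
    refine ⟨?_, ?_⟩
    · funext c d
      rw [pullTensor_eq_smul (hj y), hy.1, hAy, zero_add, pow_two]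
    · funext v
      rw [pullForm_eq_smul (hj y), hy.2, hAy, zero_add, Finset.prod_const, Finset.card_univ,
        Fintype.card_fin, ← mul_assoc, ← pow_succ, Nat.sub_add_cancel hk]

/-- Smooth cutoff functions at the origin. -/
theorem exists_cutoff {W : Set (Pt n)} (hW : IsOpen W) (h0 : (0 : Pt n) ∈ W) :
    ∃ χ : Pt n → ℝ, (∀ᶠ y in 𝓝 0, χ y = 1) ∧ (∀ y, y ∉ W → χ y = 0) ∧
      ∀ f : Pt n → ℝ, ContDiffOn ℝ (⊤ : ℕ∞) f W →
        ContDiff ℝ (⊤ : ℕ∞) fun y => χ y * f y := by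
  obtain ⟨ε, hε, hsub⟩ := Metric.nhds_basis_closedBall.mem_iff.1 (hW.mem_nhds h0)
  let χ : ContDiffBump (0 : Pt n) := ⟨ε / 2, ε, half_pos hε, half_lt_self hε⟩
  have hts : tsupport χ ⊆ W := by rw [χ.tsupport_eq]; exact hsub
  refine ⟨χ, χ.eventuallyEq_one, fun y hy => image_eq_zero_of_notMem_tsupport fun h => hy (hts h),
    fun f hf => ?_⟩
  refine contDiff_of_contDiffOn_union_of_isOpen (s := W) (t := (tsupport χ)ᶜ)
    (χ.contDiff.contDiffOn.mul hf) ?_ ?_ hW (isClosed_tsupport _).isOpen_compl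
  · refine (contDiffOn_const (c := (0 : ℝ))).congr fun y hy => ?_
    rw [image_eq_zero_of_notMem_tsupport hy, zero_mul]
  · rw [Set.eq_univ_iff_forall]
    intro y
    by_cases h : y ∈ tsupport χ
    · exact Or.inl (hts h)
    · exact Or.inr h

theorem isMetricOn_minkM (W : Set (Pt n)) : IsMetricOn n W fun _ => minkM n :=
  ⟨fun _ _ => contDiffOn_const, fun _ _ => isLorentz_minkM n⟩

theorem isFormOn_const {A : (Fin k → Fin (n + 1)) → ℝ} (hA : IsAlt n k A) (W : Set (Pt n)) :
    IsFormOn n k W fun _ => A :=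
  ⟨fun _ => contDiffOn_const, fun _ _ => hA⟩

/-- A quadratic identity: the values of a bilinear form on the vertices of the cube. -/
theorem bilin_cube (B : (Fin 4 → ℝ) →L[ℝ] (Fin 4 → ℝ) →L[ℝ] ℝ)
    (q : (Fin 4 → ℝ) → ℝ) (hq : ∀ c, q c = B c c)
    (h0 : q ![1, 0, 0, 0] = 0) (h1 : q ![0, 1, 0, 0] = 0) (h3 : q ![0, 0, 0, 1] = 0)
    (h013 : q ![1, 1, 0, 1] = 0)
    (h02 : q ![1, 0, 1, 0] = q ![0, 0, 1, 0]) (h12 : q ![0, 1, 1, 0] = q ![0, 0, 1, 0])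
    (h23 : q ![0, 0, 1, 1] = q ![0, 0, 1, 0]) :
    q ![1, 1, 1, 1] = q ![0, 0, 1, 0] := by
  have key : ∀ c : Fin 4 → ℝ, q c
      = ∑ i, ∑ j, c i * c j * B (Pi.single i 1) (Pi.single j 1) := by
    intro c
    have hc : c = ∑ i, c i • (Pi.single i 1 : Fin 4 → ℝ) := by
      funext j
      simp [Finset.sum_apply, Pi.single_apply]
    rw [hq]
    conv_lhs => rw [hc]
    simp only [map_sum, map_smul, sum_apply, smul_apply,
      smul_eq_mul, Finset.mul_sum]
    rw [Finset.sum_comm]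
    exact Finset.sum_congr rfl fun i _ => Finset.sum_congr rfl fun j _ => by ring
  simp only [key, Fin.sum_univ_four, Matrix.cons_val] at *
  linarith

/-- A scale invariant natural tensor vanishing with the form depends, at a point where the metric
is flat to first order, only on the value of the form at this point. -/
theorem NaturalTensor.eq_flat (T : NaturalTensor n k) (hk : 1 ≤ k)
    (scale : ∀ W g ω, IsOpen W → IsMetricOn n W g → IsFormOn n k W ω →
      ∀ lam : ℝ, 0 < lam → ∀ x ∈ W, ∀ a b,
        T.T W (fun y c d => lam ^ 2 * g y c d) (fun y v => lam ^ (k - 1) * ω y v) x a b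
          = T.T W g ω x a b)
    (vanish : ∀ W g ω, IsOpen W → IsMetricOn n W g → IsFormOn n k W ω →
      ∀ x ∈ W, (∀ v, ω x v = 0) → ∀ a b, T.T W g ω x a b = 0)
    {W : Set (Pt n)} {g : Pt n → Fin (n + 1) → Fin (n + 1) → ℝ}
    {ω : Pt n → (Fin k → Fin (n + 1)) → ℝ} (hW : IsOpen W) (hg : IsMetricOn n W g)
    (hω : IsFormOn n k W ω) (h0 : (0 : Pt n) ∈ W) (hg0 : ∀ a b, g 0 a b = minkM n a b)
    (hg1 : ∀ a b, fderiv ℝ (fun y => g y a b) 0 = 0) (a b : Fin (n + 1)) :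
    T.T W g ω 0 a b = T.T Set.univ (fun _ => minkM n) (fun _ => ω 0) 0 a b := by
  obtain ⟨χ, hχ1, hχ0, hχ⟩ := exists_cutoff hW h0
  set f : Fin (n + 1) → Fin (n + 1) → Pt n → ℝ := fun a b y => χ y * (g y a b - minkM n a b) with hf
  set θ : (Fin k → Fin (n + 1)) → Pt n → ℝ := fun v y => χ y * (ω y v - ω 0 v) with hθ
  have hfs : ∀ a b, ContDiff ℝ (⊤ : ℕ∞) (f a b) := fun a b =>
    hχ _ ((hg.1 a b).sub contDiffOn_const)
  have hθs : ∀ v, ContDiff ℝ (⊤ : ℕ∞) (θ v) := fun v => hχ _ ((hω.1 v).sub contDiffOn_const)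
  have hf0 : ∀ a b, f a b 0 = 0 := fun a b => by simp [hf, hg0]
  have hθ0 : ∀ v, θ v 0 = 0 := fun v => by simp [hθ]
  have hf1 : ∀ a b, fderiv ℝ (f a b) 0 = 0 := by
    intro a b
    have : f a b =ᶠ[𝓝 0] fun y => g y a b - minkM n a b := by
      filter_upwards [hχ1] with y hy
      simp [hf, hy]
    rw [this.fderiv_eq, fderiv_sub_const, hg1]
  have hfsymm : ∀ a b, f a b = f b a := by
    intro a b
    funext y
    by_cases hy : y ∈ W
    · simp only [hf, (hg.2 y hy).1 a b, minkM_comm n a b]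
    · simp [hf, hχ0 y hy]
  have hθalt : ∀ y, IsAlt n k fun v => θ v y := by
    intro y v σ
    by_cases hy : y ∈ W
    · simp only [hθ]
      rw [hω.2 y hy v σ, hω.2 0 h0 v σ]
      ring
    · simp [hθ, hχ0 y hy]
  set gF : (Fin 4 → ℝ) → Pt n → Fin (n + 1) → Fin (n + 1) → ℝ := fun s x a b =>
    minkM n a b + s 0 * rayQuotient (f a b) (s 1) x with hgF
  set ωF : (Fin 4 → ℝ) → Pt n → (Fin k → Fin (n + 1)) → ℝ := fun s x v =>
    s 2 * ω 0 v + s 3 * θ v (s 1 • x) with hωF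
  have hgFs : ∀ a b, ContDiff ℝ (⊤ : ℕ∞) fun p : (Fin 4 → ℝ) × Pt n => gF p.1 p.2 a b := by
    intro a b
    have h1 : ContDiff ℝ (⊤ : ℕ∞) fun p : (Fin 4 → ℝ) × Pt n =>
        rayQuotient (f a b) (p.1 1) p.2 :=
      (contDiff_rayQuotient (hfs a b)).comp
        (g := fun p : ℝ × Pt n => rayQuotient (f a b) p.1 p.2)
        (f := fun p : (Fin 4 → ℝ) × Pt n => (p.1 1, p.2)) (by fun_prop)
    exact contDiff_const.add ((by fun_prop : ContDiff ℝ (⊤ : ℕ∞)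
      fun p : (Fin 4 → ℝ) × Pt n => p.1 0).mul h1)
  have hωFs : ∀ v, ContDiff ℝ (⊤ : ℕ∞) fun p : (Fin 4 → ℝ) × Pt n => ωF p.1 p.2 v := by
    intro v
    have h1 : ContDiff ℝ (⊤ : ℕ∞) fun p : (Fin 4 → ℝ) × Pt n => θ v (p.1 1 • p.2) :=
      (hθs v).comp (by fun_prop)
    have h2 : ContDiff ℝ (⊤ : ℕ∞) fun p : (Fin 4 → ℝ) × Pt n => p.1 2 * ω 0 v := by fun_prop
    exact h2.add ((by fun_prop : ContDiff ℝ (⊤ : ℕ∞)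
      fun p : (Fin 4 → ℝ) × Pt n => p.1 3).mul h1)
  have hgF0 : gF 0 0 = minkM n := by
    funext a b
    simp [hgF]
  obtain ⟨δ, hδ, hLor⟩ : ∃ δ > 0, ∀ s ∈ Metric.ball (0 : Fin 4 → ℝ) δ,
      ∀ x ∈ Metric.ball (0 : Pt n) δ, IsLorentz n (gF s x) := by
    have hc : Continuous fun p : (Fin 4 → ℝ) × Pt n => gF p.1 p.2 :=
      continuous_pi fun a => continuous_pi fun b => (hgFs a b).continuous
    have h1 := hc.tendsto (0, 0)
    simp only [hgF0] at h1
    obtain ⟨δ, hδ, h2⟩ := Metric.eventually_nhds_iff_ball.1 (h1.eventually (eventually_isLorentz n))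
    refine ⟨δ, hδ, fun s hs x hx => h2 (s, x) ?_ fun a b => ?_⟩
    · rw [← ball_prod_same]
      exact ⟨hs, hx⟩
    · simp only [hgF, hfsymm a b, minkM_comm n a b]
  set D := Metric.ball (0 : Pt n) δ with hD
  have h0D : (0 : Pt n) ∈ D := Metric.mem_ball_self hδ
  have hDo : IsOpen D := Metric.isOpen_ball
  have hmet : ∀ s ∈ Metric.ball (0 : Fin 4 → ℝ) δ, IsMetricOn n D (gF s) := fun s hs =>
    ⟨fun a b => ((hgFs a b).comp (by fun_prop : ContDiff ℝ (⊤ : ℕ∞)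
      fun x : Pt n => (s, x))).contDiffOn, fun x hx => hLor s hs x hx⟩
  have hform : ∀ s, IsFormOn n k D (ωF s) := by
    refine fun s => ⟨fun v => ((hωFs v).comp (by fun_prop : ContDiff ℝ (⊤ : ℕ∞)
      fun x : Pt n => (s, x))).contDiffOn, fun x _ v σ => ?_⟩
    have h1 := hθalt (s 1 • x) v σ
    have h2 := hω.2 0 h0 v σ
    simp only [hωF] at h1 ⊢
    rw [h1, h2]
    ring
  set G : (Fin 4 → ℝ) → ℝ := fun s => T.T D (gF s) (ωF s) 0 a b with hG
  have hGs : ContDiffAt ℝ (⊤ : ℕ∞) G 0 := by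
    have h1 := T.regular 4 (Metric.ball 0 δ) D Metric.isOpen_ball hDo gF ωF
      (fun a b => (hgFs a b).contDiffOn) (fun v => (hωFs v).contDiffOn)
      (fun s hs => ⟨hmet s hs, hform s⟩) a b
    have h2 : ContDiffOn ℝ (⊤ : ℕ∞) G (Metric.ball 0 δ) :=
      h1.comp (f := fun s : Fin 4 → ℝ => (s, (0 : Pt n))) (by fun_prop) fun s hs => ⟨hs, h0D⟩
    exact h2.contDiffAt (Metric.isOpen_ball.mem_nhds (Metric.mem_ball_self hδ))
  have hball : ∀ s ∈ Metric.ball (0 : Fin 4 → ℝ) δ, ∀ r : ℝ, 0 < r → r ≤ 1 →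
      r • s ∈ Metric.ball (0 : Fin 4 → ℝ) δ := by
    intro s hs r hr hr1
    rw [mem_ball_zero_iff] at hs ⊢
    rw [norm_smul, Real.norm_of_nonneg hr.le]
    exact (mul_le_of_le_one_left (norm_nonneg s) hr1).trans_lt hs
  have hhom : ∀ᶠ s in 𝓝 (0 : Fin 4 → ℝ), ∀ r : ℝ, 0 < r → r ≤ 1 → G (r • s) = r ^ 2 * G s := by
    filter_upwards [Metric.isOpen_ball.mem_nhds (Metric.mem_ball_self hδ)] with s hs r hr hr1
    refine T.dilate hk scale hDo hDo (hmet _ (hball s hs r hr hr1)) (hform _) (hmet s hs)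
      (hform s) h0D h0D hr (Filter.Eventually.of_forall fun y => ⟨fun a b => ?_, fun v => ?_⟩) a b
    · simp only [hgF, Pi.smul_apply, smul_eq_mul, rayQuotient_smul]
      ring
    · simp only [hωF, Pi.smul_apply, smul_eq_mul, smul_smul, mul_comm r (s 1)]
      ring
  obtain ⟨B, hB⟩ := exists_bilin_of_homogeneous hGs hhom
  obtain ⟨δ', hδ', hB'⟩ := Metric.eventually_nhds_iff_ball.1
    (hB.and (Metric.isOpen_ball.mem_nhds (Metric.mem_ball_self hδ)))
  set r := δ' / 2 with hr
  have hr0 : 0 < r := half_pos hδ'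
  have hrc : ∀ c : Fin 4 → ℝ, (∀ i, c i = 0 ∨ c i = 1) → r • c ∈ Metric.ball (0 : Fin 4 → ℝ) δ' := by
    intro c hc
    rw [mem_ball_zero_iff]
    refine lt_of_le_of_lt ((pi_norm_le_iff_of_nonneg hr0.le).2 fun i => ?_) (half_lt_self hδ')
    rcases hc i with h | h <;> simp [h, abs_of_pos hr0, hr0.le]
  have hQ : ∀ c : Fin 4 → ℝ, (∀ i, c i = 0 ∨ c i = 1) → r ^ 2 * B c c = G (r • c) := by
    intro c hc
    rw [(hB' _ (hrc c hc)).1]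
    simp only [map_smul, smul_apply, smul_eq_mul]
    ring
  have hr2 : r ^ 2 ≠ 0 := pow_ne_zero 2 hr0.ne'
  have hcong : ∀ s t : Fin 4 → ℝ, gF s = gF t → ωF s = ωF t → G s = G t := by
    intro s t h1 h2
    simp only [hG, h1, h2]
  have hzero : ∀ c : Fin 4 → ℝ, (∀ i, c i = 0 ∨ c i = 1) → c 2 = 0 → B c c = 0 := by
    intro c hc hc2
    have h1 : G (r • c) = 0 := vanish D _ _ hDo (hmet _ (hB' _ (hrc c hc)).2) (hform _) 0 h0D
      (fun v => by simp [hωF, hc2, hθ0]) a b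
    exact (mul_eq_zero.1 ((hQ c hc).trans h1)).resolve_left hr2
  have heq : ∀ c d : Fin 4 → ℝ, (∀ i, c i = 0 ∨ c i = 1) → (∀ i, d i = 0 ∨ d i = 1) →
      gF (r • c) = gF (r • d) → ωF (r • c) = ωF (r • d) → B c c = B d d := by
    intro c d hc hd h1 h2
    exact mul_left_cancel₀ hr2 ((hQ c hc).trans ((hcong _ _ h1 h2).trans (hQ d hd).symm))
  have h2mem : ∀ i, (![0, 0, 1, 0] : Fin 4 → ℝ) i = 0 ∨ (![0, 0, 1, 0] : Fin 4 → ℝ) i = 1 := by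
    simp [Fin.forall_fin_succ]
  have h4mem : ∀ i, (![1, 1, 1, 1] : Fin 4 → ℝ) i = 0 ∨ (![1, 1, 1, 1] : Fin 4 → ℝ) i = 1 := by
    simp [Fin.forall_fin_succ]
  have hcube := bilin_cube B (fun c => B c c) (fun _ => rfl)
    (hzero _ (by simp [Fin.forall_fin_succ]) rfl) (hzero _ (by simp [Fin.forall_fin_succ]) rfl)
    (hzero _ (by simp [Fin.forall_fin_succ]) rfl) (hzero _ (by simp [Fin.forall_fin_succ]) rfl)
    (heq _ _ (by simp [Fin.forall_fin_succ]) h2mem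
      (by funext x a b; simp [hgF, rayQuotient_zero_left, hf1]) (by funext x v; simp [hωF]))
    (heq _ _ (by simp [Fin.forall_fin_succ]) h2mem
      (by funext x a b; simp [hgF]) (by funext x v; simp [hωF]))
    (heq _ _ (by simp [Fin.forall_fin_succ]) h2mem
      (by funext x a b; simp [hgF]) (by funext x v; simp [hωF, hθ0]))
  have hG4 : G (r • ![1, 1, 1, 1]) = r ^ 2 * T.T W g ω 0 a b := by
    refine T.dilate hk scale hDo hW (hmet _ (hB' _ (hrc _ h4mem)).2) (hform _) hg hω h0D h0 hr0
      ?_ a b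
    have ht : Filter.Tendsto (fun y : Pt n => r • y) (𝓝 0) (𝓝 0) := by
      have : Continuous fun y : Pt n => r • y := by fun_prop
      simpa using this.tendsto 0
    filter_upwards [ht.eventually hχ1] with y hy
    refine ⟨fun a b => ?_, fun v => ?_⟩
    · simp only [hgF, Pi.smul_apply, smul_eq_mul, Matrix.cons_val, mul_one,
        mul_rayQuotient (hfs a b), hf0, sub_zero]
      simp [hf, hy]
    · simp only [hωF, Pi.smul_apply, smul_eq_mul, Matrix.cons_val, mul_one]
      simp only [hθ, hy]
      ring
  have hG2 : G (r • ![0, 0, 1, 0])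
      = r ^ 2 * T.T Set.univ (fun _ => minkM n) (fun _ => ω 0) 0 a b := by
    refine T.dilate hk scale hDo isOpen_univ (hmet _ (hB' _ (hrc _ h2mem)).2) (hform _)
      (isMetricOn_minkM _) (isFormOn_const (hω.2 0 h0) _) h0D
      (Set.mem_univ _) hr0 (Filter.Eventually.of_forall fun y => ⟨fun a b => ?_, fun v => ?_⟩) a b
    · simp [hgF]
    · simp [hωF]
  refine mul_left_cancel₀ hr2 (hG4.symm.trans (Eq.trans ?_ hG2))
  rw [← hQ _ h4mem, ← hQ _ h2mem]
  exact congrArg _ hcube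

/-- The elementary alternating form `dx^{V₀} ∧ … ∧ dx^{V_{k-1}}`. -/
noncomputable def elemForm (V u : Fin k → Fin (n + 1)) : ℝ :=
  (Matrix.of fun i j => if u i = V j then (1 : ℝ) else 0).det

theorem elemForm_comm (V u : Fin k → Fin (n + 1)) : elemForm V u = elemForm u V := by
  rw [elemForm, ← Matrix.det_transpose]
  congr 1
  ext i j
  simp [eq_comm]

theorem isAlt_elemForm (V : Fin k → Fin (n + 1)) : IsAlt n k (elemForm V) := by
  intro u σ
  exact Matrix.det_permute σ (Matrix.of fun i j => if u i = V j then (1 : ℝ) else 0)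

theorem elemForm_eq_zero {V : Fin k → Fin (n + 1)} (hV : ¬ Function.Injective V) :
    elemForm V = 0 := by
  funext u
  obtain ⟨i, j, hij, hne⟩ := Function.not_injective_iff.1 hV
  exact Matrix.det_zero_of_column_eq hne fun l => by simp [hij]

theorem elemForm_insertNth (i : Fin (m + 1)) (a : Fin (n + 1)) (I : Fin m → Fin (n + 1)) :
    elemForm (i.insertNth a I : Fin (m + 1) → Fin (n + 1))
      = (-1 : ℝ) ^ (i : ℕ) • elemForm (Fin.cons a I) := by
  funext u
  rw [Pi.smul_apply, elemForm_comm, (isAlt_elemForm u).insertNth, elemForm_comm, smul_eq_mul]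

theorem elemForm_cons (b : Fin (n + 1)) (V : Fin k → Fin (n + 1))
    (u : Fin (k + 1) → Fin (n + 1)) :
    elemForm (Fin.cons b V : Fin (k + 1) → Fin (n + 1)) u = ∑ j : Fin (k + 1),
      (-1 : ℝ) ^ (j : ℕ) * ((if u j = b then 1 else 0) * elemForm V (u ∘ j.succAbove)) := by
  rw [elemForm, Matrix.det_succ_column_zero]
  refine Finset.sum_congr rfl fun j _ => ?_
  simp only [Matrix.of_apply, Fin.cons_zero, mul_assoc]
  rfl

theorem elemForm_cons_cons (a b : Fin (n + 1)) (V : Fin k → Fin (n + 1))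
    (u : Fin (k + 2) → Fin (n + 1)) :
    elemForm (Fin.cons a (Fin.cons b V : Fin (k + 1) → Fin (n + 1)) : Fin (k + 2) → Fin (n + 1)) u
      = - elemForm (Fin.cons b (Fin.cons a V : Fin (k + 1) → Fin (n + 1)) :
        Fin (k + 2) → Fin (n + 1)) u := by
  have h : (Fin.cons a (Fin.cons b V : Fin (k + 1) → Fin (n + 1)) : Fin (k + 2) → Fin (n + 1))
      = Fin.insertNth (α := fun _ => Fin (n + 1)) 1 b (Fin.cons a V : Fin (k + 1) → Fin (n + 1)) := by
    refine (Fin.insertNth_eq_iff.2 ⟨rfl, ?_⟩).symm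
    funext j
    refine Fin.cases ?_ (fun i => ?_) j
    · rfl
    · simp [Fin.removeNth, Fin.succAbove]
  rw [h, elemForm_insertNth]
  simp

theorem prod_mul_elemForm (r : Fin (n + 1) → ℝ) (V u : Fin k → Fin (n + 1)) :
    (∏ j, r (u j)) * elemForm V u = (∏ j, r (V j)) * elemForm V u := by
  rw [elemForm, ← Matrix.det_mul_column, ← Matrix.det_mul_row]
  congr 1
  ext i j
  by_cases h : u i = V j <;> simp [h]

/-- Alternating forms are combinations of the elementary ones. -/
theorem IsAlt.eq_sum {A : (Fin k → Fin (n + 1)) → ℝ} (hA : IsAlt n k A) :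
    A = ∑ V, ((k.factorial : ℝ)⁻¹ * A V) • elemForm V := by
  have h : ∀ u, ∑ V, A V * elemForm V u = k.factorial * A u := by
    intro u
    have h1 : ∀ V : Fin k → Fin (n + 1), elemForm V u
        = ∑ σ : Equiv.Perm (Fin k), ((Equiv.Perm.sign σ : ℤ) : ℝ) *
          if u ∘ σ = V then 1 else 0 := by
      intro V
      rw [elemForm, Matrix.det_apply']
      refine Finset.sum_congr rfl fun σ _ => ?_
      congr 1
      simp only [Matrix.of_apply, Finset.prod_ite_zero, Finset.prod_const_one, funext_iff,
        Function.comp_apply, Finset.mem_univ, true_imp_iff]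
    have h2 : ∀ σ : Equiv.Perm (Fin k), ∑ V, A V * (((Equiv.Perm.sign σ : ℤ) : ℝ) *
        if u ∘ σ = V then 1 else 0) = A u := by
      intro σ
      simp only [mul_ite, mul_one, mul_zero, Finset.sum_ite_eq, Finset.mem_univ, if_true, hA u σ]
      rcases Int.units_eq_one_or (Equiv.Perm.sign σ) with h | h <;> simp [h]
    simp only [h1, Finset.mul_sum]
    rw [Finset.sum_comm]
    simp only [h2, Finset.sum_const, Finset.card_univ, Fintype.card_perm, Fintype.card_fin,
      nsmul_eq_mul]
  funext u
  have hk : (k.factorial : ℝ) ≠ 0 := by positivity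
  simp only [Finset.sum_apply, Pi.smul_apply, smul_eq_mul, mul_assoc]
  rw [← Finset.mul_sum, h, inv_mul_cancel_left₀ hk]

/-- A family of coefficients satisfying the symmetries of the polarization of a natural quadratic
divergence-free tensor vanishes. -/
theorem coeff_eq_zero
    {γ : Fin (n + 1) → Fin (n + 1) → (Fin (m + 1) → Fin (n + 1)) → (Fin (m + 1) → Fin (n + 1)) → ℝ}
    (symm : ∀ a b V W, γ a b V W = γ a b W V)
    (inj : ∀ a b V W, ¬ Function.Injective V → γ a b V W = 0)
    (alt : ∀ a b (i : Fin (m + 1)) c (I : Fin m → Fin (n + 1)) W,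
      γ a b (i.insertNth c I) W = (-1) ^ (i : ℕ) * γ a b (Fin.cons c I) W)
    (div : ∀ a b j (I : Fin m → Fin (n + 1)) W,
      eps n b * γ b j (Fin.cons a I) W + eps n a * γ a j (Fin.cons b I) W = 0)
    (refl : ∀ i a b V W, (if a = i then (-1 : ℝ) else 1) * (if b = i then -1 else 1) * γ a b V W
      = (∏ j, if V j = i then (-1 : ℝ) else 1) * (∏ j, if W j = i then (-1 : ℝ) else 1) * γ a b V W)
    (a b : Fin (n + 1)) (V W : Fin (m + 1) → Fin (n + 1)) : γ a b V W = 0 := by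
  have heps : ∀ a, eps n a ≠ 0 := fun a h => by simpa [h] using eps_mul_self n a
  have hcons : ∀ a b V W l, (∀ I : Fin m → Fin (n + 1), γ a b (Fin.cons (V l) I) W = 0) →
      γ a b V W = 0 := by
    intro a b V W l h
    have h1 := alt a b l (V l) (l.removeNth V) W
    rw [Fin.insertNth_self_removeNth, h, mul_zero] at h1
    exact h1
  have hleft : ∀ a b V W l, V l = a → γ a b V W = 0 := by
    intro a b V W l hl
    refine hcons a b V W l fun I => ?_
    have h1 := div a a b I W
    rw [hl]
    exact (mul_eq_zero.1 (by linarith : eps n a * γ a b (Fin.cons a I) W = 0)).resolve_left (heps a)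
  have hright : ∀ a b V W l, W l = a → γ a b V W = 0 := fun a b V W l hl => by
    rw [symm]; exact hleft a b W V l hl
  by_cases hVi : Function.Injective V
  swap; · exact inj a b V W hVi
  by_cases h1 : ∃ l, V l = a
  · obtain ⟨l, hl⟩ := h1
    exact hleft a b V W l hl
  by_cases h2 : ∃ l, W l = a
  · obtain ⟨l, hl⟩ := h2
    exact hright a b V W l hl
  by_cases h3 : ∃ l l', V l = W l'
  · obtain ⟨l, l', hl⟩ := h3
    refine hcons a b V W l fun I => ?_
    have h4 := div (V l) a b I W
    rw [hright (V l) b _ W l' hl.symm, mul_zero, add_zero] at h4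
    exact (mul_eq_zero.1 h4).resolve_left (heps a)
  push Not at h1 h2 h3
  by_cases hab : b = a
  · subst hab
    have h4 := refl (V 0) b b V W
    have h5 : (∏ j, if V j = V 0 then (-1 : ℝ) else 1) = -1 := by
      simp [hVi.eq_iff]
    have h6 : (∏ j, if W j = V 0 then (-1 : ℝ) else 1) = 1 :=
      Finset.prod_eq_one fun j _ => if_neg (h3 0 j).symm
    rw [h5, h6, if_neg (h1 0).symm] at h4
    linarith
  · have h4 := refl a a b V W
    rw [Finset.prod_eq_one fun j _ => if_neg (h1 j), Finset.prod_eq_one fun j _ => if_neg (h2 j),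
      if_pos rfl, if_neg hab] at h4
    linarith

theorem isAlt_sum_elemForm (c : (Fin (m + 1) → Fin (n + 1)) → ℝ) :
    IsAlt n (m + 1) (∑ V, c V • elemForm V) := by
  intro v σ
  simp only [Finset.sum_apply, Pi.smul_apply, smul_eq_mul, Finset.mul_sum]
  refine Finset.sum_congr rfl fun V _ => ?_
  rw [isAlt_elemForm V v σ]
  ring

theorem contDiff_flatEnergy {E : Type*} [NormedAddCommGroup E] [NormedSpace ℝ E]
    {A : E → (Fin (m + 1) → Fin (n + 1)) → ℝ} (hA : ∀ v, ContDiff ℝ (⊤ : ℕ∞) fun y => A y v)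
    (a b : Fin (n + 1)) : ContDiff ℝ (⊤ : ℕ∞) fun y => flatEnergy n m (A y) a b := by
  unfold flatEnergy
  fun_prop

theorem flatEnergy_smul (r : ℝ) (A : (Fin (m + 1) → Fin (n + 1)) → ℝ) (a b : Fin (n + 1)) :
    flatEnergy n m (r • A) a b = r ^ 2 * flatEnergy n m A a b := by
  have h : ∀ x y : ℝ, r * x * (r * y) = r ^ 2 * (x * y) := fun x y => by ring
  simp only [flatEnergy, Pi.smul_apply, smul_eq_mul, h, mul_left_comm _ (r ^ 2), ← Finset.mul_sum]
  ring

/-- The difference between a natural tensor and the energy tensor, at the origin of Minkowski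
space and for a constant form. -/
noncomputable def NaturalTensor.defect (T : NaturalTensor n (m + 1))
    (A : (Fin (m + 1) → Fin (n + 1)) → ℝ) (a b : Fin (n + 1)) : ℝ :=
  T.T Set.univ (fun _ => minkM n) (fun _ => A) 0 a b - flatEnergy n m A a b

theorem NaturalTensor.exists_bilin_defect (T : NaturalTensor n (m + 1))
    (scale : ∀ W g ω, IsOpen W → IsMetricOn n W g → IsFormOn n (m + 1) W ω →
      ∀ lam : ℝ, 0 < lam → ∀ x ∈ W, ∀ a b,
        T.T W (fun y c d => lam ^ 2 * g y c d) (fun y v => lam ^ (m + 1 - 1) * ω y v) x a b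
          = T.T W g ω x a b) (a b : Fin (n + 1)) :
    ∃ B : ((Fin (m + 1) → Fin (n + 1)) → ℝ) →L[ℝ] ((Fin (m + 1) → Fin (n + 1)) → ℝ) →L[ℝ] ℝ,
      ∀ c, T.defect (∑ V, c V • elemForm V) a b = B c c := by
  set ω : ((Fin (m + 1) → Fin (n + 1)) → ℝ) → (Fin (m + 1) → Fin (n + 1)) → ℝ :=
    fun c => ∑ V, c V • elemForm V with hω
  set F : ((Fin (m + 1) → Fin (n + 1)) → ℝ) → ℝ := fun c => T.defect (ω c) a b with hF
  have hωs : ∀ v, ContDiff ℝ (⊤ : ℕ∞) fun c => ω c v := by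
    intro v
    simp only [hω, Finset.sum_apply, Pi.smul_apply, smul_eq_mul]
    fun_prop
  have hωalt : ∀ c, IsAlt n (m + 1) (ω c) := isAlt_sum_elemForm
  let e := Fintype.equivFin (Fin (m + 1) → Fin (n + 1))
  have hFs : ContDiff ℝ (⊤ : ℕ∞) F := by
    refine ContDiff.sub ?_ (contDiff_flatEnergy hωs a b)
    have h1 := T.regular (Fintype.card (Fin (m + 1) → Fin (n + 1))) Set.univ Set.univ isOpen_univ
      isOpen_univ (fun _ _ => minkM n) (fun s _ => ω (s ∘ e)) (fun a b => contDiffOn_const)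
      (fun v => ContDiff.contDiffOn ((hωs v).comp (by fun_prop)))
      (fun s _ => ⟨isMetricOn_minkM _, isFormOn_const (hωalt _) _⟩) a b
    rw [Set.univ_prod_univ, contDiffOn_univ] at h1
    have h2 := h1.comp (f := fun c : (Fin (m + 1) → Fin (n + 1)) → ℝ => (c ∘ e.symm, (0 : Pt n)))
      (by fun_prop)
    convert h2 using 1
    funext c
    simp [Function.comp_assoc]
  have hFh : ∀ (r : ℝ) c, 0 < r → F (r • c) = r ^ 2 * F c := by
    intro r c hr
    have h1 : ω (r • c) = r • ω c := by
      simp [hω, Finset.smul_sum, smul_smul]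
    simp only [hF, NaturalTensor.defect, mul_sub, h1, flatEnergy_smul]
    congr 1
    have h2 := hωalt (r • c)
    rw [h1] at h2
    exact T.dilate (Nat.le_add_left 1 m) scale isOpen_univ isOpen_univ (isMetricOn_minkM _)
      (isFormOn_const h2 _) (isMetricOn_minkM _)
      (isFormOn_const (hωalt c) _) (Set.mem_univ _) (Set.mem_univ _) hr
      (Filter.Eventually.of_forall fun y => ⟨fun _ _ => rfl, fun _ => rfl⟩) a b
  obtain ⟨B, hB⟩ := exists_bilin_of_homogeneous hFs.contDiffAt
    (Filter.Eventually.of_forall fun c r hr _ => hFh r c hr)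
  refine ⟨B, fun c => ?_⟩
  have ht : Filter.Tendsto (fun r : ℝ => r • c) (𝓝[>] 0) (𝓝 0) := by
    have : Continuous fun r : ℝ => r • c := by fun_prop
    have := this.tendsto 0
    rw [zero_smul] at this
    exact this.mono_left nhdsWithin_le_nhds
  obtain ⟨r, hr, hr0⟩ := ((ht.eventually hB).and self_mem_nhdsWithin).exists
  have hr0 : (0 : ℝ) < r := hr0
  rw [hFh r c hr0] at hr
  simp only [map_smul, smul_apply, smul_eq_mul] at hr
  refine mul_left_cancel₀ (pow_ne_zero 2 hr0.ne') (hr.trans ?_)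
  ring

theorem exists_affine_diffeo {J : Matrix (Fin (n + 1)) (Fin (n + 1)) ℝ} (hJ : IsUnit J.det)
    (p : Pt n) : ∃ τ σf, IsDiffeoOn n τ σf Set.univ Set.univ ∧ (∀ y, τ y = p + J.vecMul y) ∧
      ∀ x a c, jac n τ x a c = J a c := by
  have hJt : IsUnit J.transpose.det := by rwa [Matrix.det_transpose]
  let A : Pt n ≃L[ℝ] Pt n := (Matrix.toLinearEquiv' J.transpose
    (J.transpose.invertibleOfIsUnitDet hJt)).toContinuousLinearEquiv
  have hA : ∀ y, A y = J.vecMul y := fun y => Matrix.mulVec_transpose J y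
  refine ⟨_, _, isDiffeoOn_affine p A, fun y => by rw [hA], fun x a c => ?_⟩
  rw [jac_affine, hA, Matrix.single_one_vecMul]
  rfl

theorem NaturalTensor.defect_reflect (T : NaturalTensor n (m + 1)) {r : Fin (n + 1) → ℝ}
    (hr : ∀ a, r a * r a = 1) {A : (Fin (m + 1) → Fin (n + 1)) → ℝ} (hA : IsAlt n (m + 1) A)
    (a b : Fin (n + 1)) :
    T.defect (fun v => (∏ j, r (v j)) * A v) a b = r a * r b * T.defect A a b := by
  have hJ : IsUnit (Matrix.diagonal r).det := by
    rw [Matrix.det_diagonal]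
    exact IsUnit.of_mul_eq_one (∏ a, r a) (by rw [← Finset.prod_mul_distrib]; simp [hr])
  obtain ⟨τ, σf, hτ, hτy, hj⟩ := exists_affine_diffeo hJ 0
  have hj' : ∀ x a c, jac n τ x a c = if a = c then r a else 0 := fun x a c => by
    rw [hj, Matrix.diagonal_apply]
  have hη : ∀ a b, r a * r b * minkM n a b = minkM n a b := by
    intro a b
    by_cases h : a = b
    · rw [h, hr, one_mul]
    · simp [minkM, h]
  have hA' : IsAlt n (m + 1) fun v => (∏ j, r (v j)) * A v := by
    intro v σ
    have h1 : ∏ j, r ((v ∘ σ) j) = ∏ j, r (v j) := Equiv.prod_comp σ fun j => r (v j)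
    simp only [h1, hA v σ]
    ring
  have h1 := T.natural_germ hτ isOpen_univ isOpen_univ (isMetricOn_minkM _)
    (isFormOn_const hA' _) (isMetricOn_minkM _) (isFormOn_const hA _) (Set.mem_univ (0 : Pt n))
    (Set.mem_univ _) (Set.mem_univ _) (Filter.Eventually.of_forall fun y => ⟨?_, ?_⟩) a b
  · have h2 := energyTensor_pull (x := (0 : Pt n)) (y := (0 : Pt n)) (g := fun _ => minkM n)
      (g' := fun _ => minkM n) (ω := fun _ => A) (ω' := fun _ v => (∏ j, r (v j)) * A v) hJ
      (fun a b => ?_) (fun v => ?_) a b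
    · simp only [energyTensor_flat, Matrix.diagonal_apply, ite_mul, zero_mul, mul_ite, mul_zero,
        Finset.sum_ite_eq, Finset.mem_univ, if_true] at h2
      have h0 : τ 0 = 0 := by simp [hτy]
      rw [pullTensor_eq_smul (hj' 0), h0] at h1
      rw [NaturalTensor.defect, NaturalTensor.defect, h1, h2]
      ring
    · simp [Matrix.diagonal_apply, hη]
    · rw [← pullForm_eq_smul (hj' 0) (fun _ => A)]
      simp only [pullForm, hj]
  · funext a b
    rw [pullTensor_eq_smul (hj' y), hη]
  · funext v
    rw [pullForm_eq_smul (hj' y)]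

/-- In Minkowski space the value of a natural tensor at a point is determined by the value of the
form at this point. -/
theorem NaturalTensor.eq_const (T : NaturalTensor n k) (hk : 1 ≤ k)
    (scale : ∀ W g ω, IsOpen W → IsMetricOn n W g → IsFormOn n k W ω →
      ∀ lam : ℝ, 0 < lam → ∀ x ∈ W, ∀ a b,
        T.T W (fun y c d => lam ^ 2 * g y c d) (fun y v => lam ^ (k - 1) * ω y v) x a b
          = T.T W g ω x a b)
    (vanish : ∀ W g ω, IsOpen W → IsMetricOn n W g → IsFormOn n k W ω →
      ∀ x ∈ W, (∀ v, ω x v = 0) → ∀ a b, T.T W g ω x a b = 0)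
    {ω : Pt n → (Fin k → Fin (n + 1)) → ℝ} (hω : IsFormOn n k Set.univ ω) (x : Pt n)
    (a b : Fin (n + 1)) :
    T.T Set.univ (fun _ => minkM n) ω x a b
      = T.T Set.univ (fun _ => minkM n) (fun _ => ω x) 0 a b := by
  obtain ⟨τ, σf, hτ, hτy, hj⟩ := exists_affine_diffeo (n := n) (J := 1) (by simp) x
  have hj' : ∀ x a c, jac n τ x a c = if a = c then (fun _ => 1) a else 0 := fun x a c => by
    rw [hj, Matrix.one_apply]
  have h0 : τ 0 = x := by simp [hτy]
  have h1 := T.natural_germ hτ isOpen_univ isOpen_univ (isMetricOn_minkM _)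
    (hω.pull hτ) (isMetricOn_minkM _) hω (Set.mem_univ (0 : Pt n))
    (Set.mem_univ _) (Set.mem_univ _) (Filter.Eventually.of_forall fun y => ⟨?_, rfl⟩) a b
  · rw [pullTensor_eq_smul (hj' 0), h0, one_mul, one_mul] at h1
    rw [← h1, T.eq_flat hk scale vanish isOpen_univ (isMetricOn_minkM _) (hω.pull hτ)
      (Set.mem_univ _) (fun _ _ => rfl) (fun _ _ => by simp)]
    have h2 : pullForm n k τ ω 0 = ω x := by
      funext v
      rw [pullForm_eq_smul (hj' 0), h0]
      simp
    rw [h2]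
  · funext a b
    rw [pullTensor_eq_smul (hj' y)]
    simp

/-- The divergence condition for the closed affine forms
`e_W + x_b dx^a ∧ dx^I + x_a dx^b ∧ dx^I`. -/
theorem NaturalTensor.sum_bilin_affine (T : NaturalTensor n (m + 1))
    (scale : ∀ W g ω, IsOpen W → IsMetricOn n W g → IsFormOn n (m + 1) W ω →
      ∀ lam : ℝ, 0 < lam → ∀ x ∈ W, ∀ a b,
        T.T W (fun y c d => lam ^ 2 * g y c d) (fun y v => lam ^ (m + 1 - 1) * ω y v) x a b
          = T.T W g ω x a b)
    (vanish : ∀ W g ω, IsOpen W → IsMetricOn n W g → IsFormOn n (m + 1) W ω →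
      ∀ x ∈ W, (∀ v, ω x v = 0) → ∀ a b, T.T W g ω x a b = 0)
    (divcond : ∀ W g ω, IsOpen W → IsMetricOn n W g → IsFormOn n (m + 1) W ω →
      (∀ x ∈ W, ∀ u, dext n (m + 1) ω x u = 0) →
      ∀ x ∈ W, ∀ b, divT n g (T.T W g ω) x b = - iCodiff n (m + 1) g ω x b)
    {B : Fin (n + 1) → Fin (n + 1) →
      ((Fin (m + 1) → Fin (n + 1)) → ℝ) →L[ℝ] ((Fin (m + 1) → Fin (n + 1)) → ℝ) →L[ℝ] ℝ}
    (hB : ∀ a b c, T.defect (∑ V, c V • elemForm V) a b = B a b c c)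
    (a b j : Fin (n + 1)) (I : Fin m → Fin (n + 1)) (W : Fin (m + 1) → Fin (n + 1)) :
    eps n b * (B b j (Pi.single (Fin.cons a I) 1) (Pi.single W 1)
        + B b j (Pi.single W 1) (Pi.single (Fin.cons a I) 1))
      + eps n a * (B a j (Pi.single (Fin.cons b I) 1) (Pi.single W 1)
        + B a j (Pi.single W 1) (Pi.single (Fin.cons b I) 1)) = 0 := by
  set X : (Fin (m + 1) → Fin (n + 1)) → ℝ := Pi.single (Fin.cons a I) 1 with hX
  set Y : (Fin (m + 1) → Fin (n + 1)) → ℝ := Pi.single (Fin.cons b I) 1 with hY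
  set Z : (Fin (m + 1) → Fin (n + 1)) → ℝ := Pi.single W 1 with hZ
  set c : Pt n → (Fin (m + 1) → Fin (n + 1)) → ℝ := fun y => Z + (y b • X + y a • Y) with hc
  set ω : Pt n → (Fin (m + 1) → Fin (n + 1)) → ℝ := fun y => ∑ V, c y V • elemForm V with hω
  have hωv : ∀ y v, ω y v = elemForm W v + (y b * elemForm (Fin.cons a I) v
      + y a * elemForm (Fin.cons b I) v) := by
    intro y v
    simp [hω, hc, hX, hY, hZ, Finset.sum_apply, add_mul, Finset.sum_add_distrib,
      Pi.single_apply]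
  have hωs : ∀ v, ContDiff ℝ (⊤ : ℕ∞) fun y => ω y v := by
    intro v
    simp only [hωv]
    fun_prop
  have halt : ∀ y, IsAlt n (m + 1) (ω y) := fun y => isAlt_sum_elemForm _
  have hωf : IsFormOn n (m + 1) Set.univ ω := ⟨fun v => (hωs v).contDiffOn, fun y _ => halt y⟩
  have hpd : ∀ x d v, pd n d (fun y => ω y v) x = (if b = d then 1 else 0) * elemForm (Fin.cons a I) v
      + (if a = d then 1 else 0) * elemForm (Fin.cons b I) v := by
    intro x d v
    have h1 := ((hasFDerivAt_apply (𝕜 := ℝ) b x).mul_const (elemForm (Fin.cons a I) v)).add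
      ((hasFDerivAt_apply (𝕜 := ℝ) a x).mul_const (elemForm (Fin.cons b I) v))
    have h2 := (h1.const_add (elemForm W v)).fderiv
    have h3 := congrArg (fun L => L (Pi.single d 1)) h2
    simp only [pd, hωv]
    refine Eq.trans h3 ?_
    simp [Pi.single_apply]
  have hclosed : ∀ x u, dext n (m + 1) ω x u = 0 := by
    intro x u
    have h1 := elemForm_cons b (Fin.cons a I) u
    have h2 := elemForm_cons a (Fin.cons b I) u
    have h3 := elemForm_cons_cons a b I u
    simp only [dext, hpd, mul_add, Finset.sum_add_distrib]
    rw [h2, h1] at h3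
    simp only [eq_comm (a := b), eq_comm (a := a)]
    linarith
  have hdiv := divcond Set.univ (fun _ => minkM n) ω isOpen_univ (isMetricOn_minkM _) hωf
    (fun x _ => hclosed x) 0 (Set.mem_univ _) j
  rw [divT_flat, ← div_flatEnergy (fun v => ((hωs v).differentiable (by simp)) 0) (halt 0)
    (hclosed 0)] at hdiv
  have hT : ∀ d y, T.T Set.univ (fun _ => minkM n) ω y d j
      = B d j (c y) (c y) + flatEnergy n m (ω y) d j := by
    intro d y
    rw [T.eq_const (Nat.le_add_left 1 m) scale vanish hωf, ← hB, NaturalTensor.defect]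
    simp only [hω]
    ring
  have hcd : HasFDerivAt c ((ContinuousLinearMap.proj b).smulRight X
      + (ContinuousLinearMap.proj a).smulRight Y : Pt n →L[ℝ] _) 0 :=
    (((hasFDerivAt_apply (𝕜 := ℝ) b (0 : Pt n)).smul_const X).add
      ((hasFDerivAt_apply (𝕜 := ℝ) a (0 : Pt n)).smul_const Y)).const_add Z
  have hpdB : ∀ d, pd n d (fun y => T.T Set.univ (fun _ => minkM n) ω y d j) 0
      = ((if b = d then 1 else 0) * (B d j X Z + B d j Z X)
        + (if a = d then 1 else 0) * (B d j Y Z + B d j Z Y))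
      + pd n d (fun y => flatEnergy n m (ω y) d j) 0 := by
    intro d
    have h1 := (B d j).hasFDerivAt_of_bilinear hcd hcd
    have h2 := ((contDiff_flatEnergy hωs d j).differentiable (by simp) 0).hasFDerivAt
    have h3 := congrArg (fun L => L (Pi.single d 1)) (h1.add h2).fderiv
    simp only [hT, pd]
    refine Eq.trans h3 ?_
    have hc0 : c 0 = Z := by simp [hc]
    by_cases hbd : b = d <;> by_cases had : a = d <;> simp [hc0, hbd, had] <;>
      ring
  simp only [hpdB, mul_add, Finset.sum_add_distrib] at hdiv
  simp at hdiv
  linarith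

theorem sum_single_smul_elemForm (V : Fin (m + 1) → Fin (n + 1)) :
    ∑ U, (Pi.single V 1 : (Fin (m + 1) → Fin (n + 1)) → ℝ) U • elemForm U = elemForm V := by
  simp [Pi.single_apply]

theorem NaturalTensor.defect_eq_zero (T : NaturalTensor n (m + 1))
    (scale : ∀ W g ω, IsOpen W → IsMetricOn n W g → IsFormOn n (m + 1) W ω →
      ∀ lam : ℝ, 0 < lam → ∀ x ∈ W, ∀ a b,
        T.T W (fun y c d => lam ^ 2 * g y c d) (fun y v => lam ^ (m + 1 - 1) * ω y v) x a b
          = T.T W g ω x a b)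
    (vanish : ∀ W g ω, IsOpen W → IsMetricOn n W g → IsFormOn n (m + 1) W ω →
      ∀ x ∈ W, (∀ v, ω x v = 0) → ∀ a b, T.T W g ω x a b = 0)
    (divcond : ∀ W g ω, IsOpen W → IsMetricOn n W g → IsFormOn n (m + 1) W ω →
      (∀ x ∈ W, ∀ u, dext n (m + 1) ω x u = 0) →
      ∀ x ∈ W, ∀ b, divT n g (T.T W g ω) x b = - iCodiff n (m + 1) g ω x b)
    {A : (Fin (m + 1) → Fin (n + 1)) → ℝ} (hA : IsAlt n (m + 1) A) (a b : Fin (n + 1)) :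
    T.defect A a b = 0 := by
  choose B hB using T.exists_bilin_defect scale
  let δ : (Fin (m + 1) → Fin (n + 1)) → (Fin (m + 1) → Fin (n + 1)) → ℝ := fun V => Pi.single V 1
  let γ : Fin (n + 1) → Fin (n + 1) → (Fin (m + 1) → Fin (n + 1)) →
    (Fin (m + 1) → Fin (n + 1)) → ℝ := fun a b V W => B a b (δ V) (δ W) + B a b (δ W) (δ V)
  have hcomb : ∀ a b s t V W, T.defect (s • elemForm V + t • elemForm W) a b
      = s ^ 2 * T.defect (elemForm V) a b + t ^ 2 * T.defect (elemForm W) a b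
        + s * t * γ a b V W := by
    intro a b s t V W
    have h1 : ∀ V, T.defect (elemForm V) a b = B a b (δ V) (δ V) := fun V => by
      rw [← hB, sum_single_smul_elemForm]
    have h2 : s • elemForm V + t • elemForm W = ∑ U, (s • δ V + t • δ W) U • elemForm U := by
      simp only [Pi.add_apply, Pi.smul_apply, add_smul, Finset.sum_add_distrib, smul_eq_mul,
        mul_smul, ← Finset.smul_sum, δ, sum_single_smul_elemForm]
    rw [h2, hB, h1, h1]
    simp only [map_add, map_smul, add_apply, smul_apply, smul_eq_mul, γ]
    ring
  have hsm : ∀ a b s V, T.defect (s • elemForm V) a b = s ^ 2 * T.defect (elemForm V) a b := by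
    intro a b s V
    have := hcomb a b s 0 V V
    simpa using this
  have hγ : ∀ a b V W, γ a b V W = 0 := by
    intro a b V W
    refine coeff_eq_zero (γ := γ) (fun a b V W => add_comm _ _) (fun a b V W hV => ?_)
      (fun a b i c I W => ?_) (fun a b j I W => ?_) (fun i a b V W => ?_) a b V W
    · have h1 := hcomb a b 1 1 V W
      have h2 := hsm a b 0 V
      rw [elemForm_eq_zero hV] at h1 h2
      simp only [smul_zero, zero_add, one_smul] at h1 h2
      linarith
    · have h1 := hcomb a b 1 1 (i.insertNth c I) W
      have h2 := hcomb a b ((-1) ^ (i : ℕ)) 1 (Fin.cons c I) W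
      have h3 := hsm a b ((-1) ^ (i : ℕ)) (Fin.cons c I)
      rw [elemForm_insertNth, one_smul, h3] at h1
      linarith
    · exact T.sum_bilin_affine scale vanish divcond hB a b j I W
    · set r : Fin (n + 1) → ℝ := fun a => if a = i then -1 else 1
      have hr : ∀ a, r a * r a = 1 := fun a => by simp only [r]; split_ifs <;> norm_num
      have hV : ∀ V : Fin (m + 1) → Fin (n + 1), IsAlt n (m + 1) (elemForm V) := isAlt_elemForm
      have hp : ∀ V : Fin (m + 1) → Fin (n + 1), (fun u => (∏ j, r (u j)) * elemForm V u) = (∏ j, r (V j)) • elemForm V :=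
        fun V => funext fun u => prod_mul_elemForm r V u
      have h1 := T.defect_reflect hr (isAlt_elemForm V) a b
      have h2 := T.defect_reflect hr (isAlt_elemForm W) a b
      have h3 := T.defect_reflect (A := (1 : ℝ) • elemForm V + (1 : ℝ) • elemForm W) hr ?_ a b
      · have hp' : (fun u => (∏ j, r (u j)) * ((1 : ℝ) • elemForm V + (1 : ℝ) • elemForm W) u)
            = (∏ j, r (V j)) • elemForm V + (∏ j, r (W j)) • elemForm W := by
          rw [← hp, ← hp]
          funext u
          simp [mul_add]
        rw [hp', hcomb, hcomb] at h3
        rw [hp, hsm] at h1 h2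
        change r a * r b * γ a b V W = (∏ j, r (V j)) * (∏ j, r (W j)) * γ a b V W
        linarith
      · intro u σ
        simp only [Pi.add_apply, one_smul, hV V u σ, hV W u σ]
        ring
  have hlin : ∀ c : (Fin (m + 1) → Fin (n + 1)) → ℝ, c = ∑ V, c V • δ V := fun c => by
    funext V
    simp [δ, Pi.single_apply]
  have hsum : ∀ c, B a b c c = ∑ V, ∑ W, c V * c W * B a b (δ V) (δ W) := fun c => by
    conv_lhs => rw [hlin c]
    simp only [map_sum, map_smul, sum_apply, smul_apply, smul_eq_mul, Finset.mul_sum, mul_assoc]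
    rw [Finset.sum_comm]
    exact Finset.sum_congr rfl fun V _ => Finset.sum_congr rfl fun W _ => by ring
  rw [hA.eq_sum, hB, hsum]
  set c : (Fin (m + 1) → Fin (n + 1)) → ℝ := fun V => ((m + 1).factorial : ℝ)⁻¹ * A V
  have h1 : ∑ V, ∑ W, c V * c W * B a b (δ V) (δ W)
      + ∑ V, ∑ W, c V * c W * B a b (δ V) (δ W) = 0 := by
    nth_rewrite 2 [Finset.sum_comm]
    rw [← Finset.sum_add_distrib]
    refine Finset.sum_eq_zero fun V _ => ?_
    rw [← Finset.sum_add_distrib]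
    refine Finset.sum_eq_zero fun W _ => ?_
    have := hγ a b V W
    linear_combination c V * c W * this
  linarith

theorem exists_isDiffeoOn {τ : Pt n → Pt n} (hτ : ContDiff ℝ (⊤ : ℕ∞) τ) {x : Pt n}
    (hx : HasFDerivAt τ (ContinuousLinearMap.id ℝ (Pt n)) x) {W : Set (Pt n)} (hW : IsOpen W)
    (hxW : τ x ∈ W) : ∃ σf U U', IsDiffeoOn n τ σf U U' ∧ x ∈ U ∧ U' ⊆ W := by
  let S : Set (Pt n) := fderiv ℝ τ ⁻¹' Set.range ((↑) : (Pt n ≃L[ℝ] Pt n) → Pt n →L[ℝ] Pt n)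
  have hS : IsOpen S :=
    (ContinuousLinearEquiv.isOpen (𝕜 := ℝ)).preimage (hτ.continuous_fderiv (by simp))
  have hxS : x ∈ S := ⟨ContinuousLinearEquiv.refl ℝ (Pt n), hx.fderiv.symm⟩
  have hx' : HasFDerivAt τ (ContinuousLinearEquiv.refl ℝ (Pt n) : Pt n →L[ℝ] Pt n) x := hx
  let φ := (hτ.contDiffAt.toOpenPartialHomeomorph τ hx' (by simp)).restrOpen S hS
  have hφ : ∀ y, φ y = τ y := fun _ => rfl
  have hφs : φ.source ⊆ S := Set.inter_subset_right
  have hd : IsDiffeoOn n τ φ.symm φ.source φ.target :=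
    { open_src := φ.open_source
      open_tgt := φ.open_target
      mapsTo := φ.mapsTo
      mapsTo_inv := φ.mapsTo_symm
      left_inv := fun y hy => φ.left_inv hy
      right_inv := fun y hy => φ.right_inv hy
      smooth := hτ.contDiffOn
      smooth_inv := fun y hy => by
        obtain ⟨f', hf'⟩ := hφs (φ.map_target hy)
        refine (φ.contDiffAt_symm hy (f₀' := f') ?_ hτ.contDiffAt).contDiffWithinAt
        rw [hf']
        exact ((hτ.differentiable (by simp)) _).hasFDerivAt }
  exact ⟨_, _, _, hd.restrict hW,
    ⟨⟨hτ.contDiffAt.mem_toOpenPartialHomeomorph_source hx' (by simp), hxS⟩, hxW⟩,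
    Set.inter_subset_right⟩

/-- A coordinate change, tangent to the identity, that kills the first derivatives at the origin
of a metric with value `minkM n` there. -/
theorem exists_normal_coordinates {W : Set (Pt n)} (hW : IsOpen W) (h0 : (0 : Pt n) ∈ W)
    {g : Pt n → Fin (n + 1) → Fin (n + 1) → ℝ} (hg : IsMetricOn n W g)
    (hg0 : ∀ a b, g 0 a b = minkM n a b) :
    ∃ τ σf U U', IsDiffeoOn n τ σf U U' ∧ (0 : Pt n) ∈ U ∧ U' ⊆ W ∧ τ 0 = 0 ∧
      (∀ a c, jac n τ 0 a c = if a = c then 1 else 0) ∧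
      ∀ a b, fderiv ℝ (fun y => pullTensor n τ g y a b) 0 = 0 := by
  let D : Fin (n + 1) → Fin (n + 1) → Fin (n + 1) → ℝ := fun i a b => pd n i (fun y => g y a b) 0
  have hgd : ∀ a b, DifferentiableAt ℝ (fun y => g y a b) 0 := fun a b =>
    ((hg.1 a b).contDiffAt (hW.mem_nhds h0)).differentiableAt (by simp)
  have hD : ∀ i a b, D i a b = D i b a := fun i a b => by
    have h1 : (fun y => g y a b) =ᶠ[𝓝 0] fun y => g y b a := by
      filter_upwards [hW.mem_nhds h0] with y hy using (hg.2 y hy).1 a b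
    simp only [D, pd, h1.fderiv_eq]
  let Γ : Fin (n + 1) → Fin (n + 1) → Fin (n + 1) → ℝ := fun c a b =>
    eps n c * (1 / 2) * (D a c b + D b c a - D c a b)
  have hΓ : ∀ c a b, Γ c a b = Γ c b a := fun c a b => by
    simp only [Γ, hD c a b]
    ring
  let τ : Pt n → Pt n := fun y c => y c - 1 / 2 * ∑ a, ∑ b, Γ c a b * (y a * y b)
  have hτ : ContDiff ℝ (⊤ : ℕ∞) τ := by
    rw [contDiff_pi]
    intro c
    fun_prop
  have hjac : ∀ y a c, jac n τ y a c = (if a = c then 1 else 0) - ∑ e, Γ c a e * y e := by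
    intro y a c
    have h1 : HasFDerivAt (fun y => τ y c) _ y := (hasFDerivAt_apply (𝕜 := ℝ) c y).sub
      ((HasFDerivAt.fun_sum fun a _ => HasFDerivAt.fun_sum fun b _ =>
        ((hasFDerivAt_apply (𝕜 := ℝ) a y).mul (hasFDerivAt_apply (𝕜 := ℝ) b y)).const_mul
          (Γ c a b)).const_mul (1 / 2 : ℝ))
    have h2 : jac n τ y a c = fderiv ℝ (fun y => τ y c) y (Pi.single a 1) := by
      rw [jac, fderiv_pi fun c => by fun_prop]
      rfl
    rw [h2, h1.fderiv]
    simp [Pi.single_apply, Finset.sum_add_distrib]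
    simp only [hΓ c _ a, eq_comm (a := c)]
    ring
  have hτ0 : τ 0 = 0 := by
    funext c
    simp [τ]
  have hj0 : ∀ a c, jac n τ 0 a c = if a = c then 1 else 0 := fun a c => by simp [hjac]
  have hτd : HasFDerivAt τ (ContinuousLinearMap.id ℝ (Pt n)) 0 := by
    have h1 := ((hτ.differentiable (by simp)) 0).hasFDerivAt
    suffices h2 : fderiv ℝ τ 0 = ContinuousLinearMap.id ℝ (Pt n) by rwa [h2] at h1
    apply ContinuousLinearMap.coe_injective
    refine (Pi.basisFun ℝ (Fin (n + 1))).ext fun a => ?_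
    funext c
    have := hj0 a c
    simp only [jac] at this
    simp [this, Pi.single_apply, eq_comm]
  obtain ⟨σf, U, U', hd, h0U, hU'⟩ := exists_isDiffeoOn hτ hτd hW (by rwa [hτ0])
  refine ⟨τ, σf, U, U', hd, h0U, hU', hτ0, hj0, fun a b => ?_⟩
  have hgτ : ∀ c d, HasFDerivAt (fun y => g (τ y) c d) (fderiv ℝ (fun y => g y c d) 0) 0 := by
    intro c d
    have h1 := (hgd c d).hasFDerivAt
    rw [← hτ0] at h1
    have h2 := HasFDerivAt.comp (0 : Pt n) h1 hτd
    rwa [hτ0, ContinuousLinearMap.comp_id] at h2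
  have hP : ∀ a c, HasFDerivAt (fun y => jac n τ y a c)
      (-∑ e, Γ c a e • ContinuousLinearMap.proj (R := ℝ) (φ := fun _ => ℝ) e) (0 : Pt n) := by
    intro a c
    simp only [hjac]
    exact (HasFDerivAt.fun_sum fun e _ =>
      (hasFDerivAt_apply (𝕜 := ℝ) e (0 : Pt n)).const_mul (Γ c a e)).const_sub _
  have hF : HasFDerivAt (fun y => pullTensor n τ g y a b) _ 0 :=
    HasFDerivAt.fun_sum fun c _ => HasFDerivAt.fun_sum fun d _ => ((hP a c).mul (hP b d)).mul (hgτ c d)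
  apply ContinuousLinearMap.coe_injective
  refine (Pi.basisFun ℝ (Fin (n + 1))).ext fun i => ?_
  rw [hF.fderiv]
  have hm : ∀ c d, minkM n c d = if c = d then eps n c else 0 := fun _ _ => rfl
  have hDi : ∀ c d, fderiv ℝ (fun y => g y c d) 0 (Pi.single i 1) = D i c d := fun _ _ => rfl
  simp [hj0, hτ0, hg0, Pi.single_apply, hm, hDi, Finset.sum_add_distrib]
  simp only [Γ, hD b a i, hD a b i, hD i b a]
  linear_combination (-(D b i a + D i a b - D a i b) / 2) * eps_mul_self n a
    - ((D a i b + D i a b - D b i a) / 2) * eps_mul_self n b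

theorem NaturalTensor.eq_energyTensor_of_eq_minkM (T : NaturalTensor n (m + 1))
    (scale : ∀ W g ω, IsOpen W → IsMetricOn n W g → IsFormOn n (m + 1) W ω →
      ∀ lam : ℝ, 0 < lam → ∀ x ∈ W, ∀ a b,
        T.T W (fun y c d => lam ^ 2 * g y c d) (fun y v => lam ^ (m + 1 - 1) * ω y v) x a b
          = T.T W g ω x a b)
    (vanish : ∀ W g ω, IsOpen W → IsMetricOn n W g → IsFormOn n (m + 1) W ω →
      ∀ x ∈ W, (∀ v, ω x v = 0) → ∀ a b, T.T W g ω x a b = 0)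
    (divcond : ∀ W g ω, IsOpen W → IsMetricOn n W g → IsFormOn n (m + 1) W ω →
      (∀ x ∈ W, ∀ u, dext n (m + 1) ω x u = 0) →
      ∀ x ∈ W, ∀ b, divT n g (T.T W g ω) x b = - iCodiff n (m + 1) g ω x b)
    {W : Set (Pt n)} (hW : IsOpen W) (h0 : (0 : Pt n) ∈ W)
    {g : Pt n → Fin (n + 1) → Fin (n + 1) → ℝ} (hg : IsMetricOn n W g)
    {ω : Pt n → (Fin (m + 1) → Fin (n + 1)) → ℝ} (hω : IsFormOn n (m + 1) W ω)
    (hg0 : ∀ a b, g 0 a b = minkM n a b) (a b : Fin (n + 1)) :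
    T.T W g ω 0 a b = energyTensor n (m + 1) g ω 0 a b := by
  obtain ⟨τ, σf, U, U', hd, h0U, hU', hτ0, hj, hg1⟩ := exists_normal_coordinates hW h0 hg hg0
  have hgU := hg.mono hU'
  have hωU := hω.mono hU'
  have hj' : ∀ a c, jac n τ 0 a c = if a = c then (fun _ => 1) a else 0 := hj
  have hpg : ∀ a b, pullTensor n τ g 0 a b = minkM n a b := fun a b => by
    rw [pullTensor_eq_smul hj', hτ0, hg0, one_mul, one_mul]
  have hpω : pullForm n (m + 1) τ ω 0 = ω 0 := by
    funext v
    rw [pullForm_eq_smul hj', hτ0]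
    simp
  have h1 := T.natural_germ hd hd.open_src hW (hgU.pull hd) (hωU.pull hd) hg hω h0U h0U
    (by rwa [hτ0]) (Filter.Eventually.of_forall fun y => ⟨rfl, rfl⟩) a b
  rw [pullTensor_eq_smul hj', hτ0, one_mul, one_mul,
    T.eq_flat (Nat.le_add_left 1 m) scale vanish hd.open_src (hgU.pull hd) (hωU.pull hd) h0U hpg
      hg1, hpω] at h1
  have h2 := T.defect_eq_zero scale vanish divcond (hω.2 0 h0) a b
  rw [NaturalTensor.defect, h1, sub_eq_zero] at h2
  have h3 := energyTensor_flat n m ω 0 a b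
  rw [h2, ← h3]
  simp only [energyTensor, iiInner, scalarSq, ginv, hg0]

theorem NaturalTensor.eq_energyTensor (T : NaturalTensor n (m + 1))
    (scale : ∀ W g ω, IsOpen W → IsMetricOn n W g → IsFormOn n (m + 1) W ω →
      ∀ lam : ℝ, 0 < lam → ∀ x ∈ W, ∀ a b,
        T.T W (fun y c d => lam ^ 2 * g y c d) (fun y v => lam ^ (m + 1 - 1) * ω y v) x a b
          = T.T W g ω x a b)
    (vanish : ∀ W g ω, IsOpen W → IsMetricOn n W g → IsFormOn n (m + 1) W ω →
      ∀ x ∈ W, (∀ v, ω x v = 0) → ∀ a b, T.T W g ω x a b = 0)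
    (divcond : ∀ W g ω, IsOpen W → IsMetricOn n W g → IsFormOn n (m + 1) W ω →
      (∀ x ∈ W, ∀ u, dext n (m + 1) ω x u = 0) →
      ∀ x ∈ W, ∀ b, divT n g (T.T W g ω) x b = - iCodiff n (m + 1) g ω x b)
    {W : Set (Pt n)} (hW : IsOpen W)
    {g : Pt n → Fin (n + 1) → Fin (n + 1) → ℝ} (hg : IsMetricOn n W g)
    {ω : Pt n → (Fin (m + 1) → Fin (n + 1)) → ℝ} (hω : IsFormOn n (m + 1) W ω)
    {x : Pt n} (hx : x ∈ W) (a b : Fin (n + 1)) :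
    T.T W g ω x a b = energyTensor n (m + 1) g ω x a b := by
  obtain ⟨-, P, hP, hPg⟩ := isLorentz_iff.1 (hg.2 x hx : IsLorentz n (g x))
  set J := P.transpose with hJdef
  have hJ : IsUnit J.det := by rwa [Matrix.det_transpose]
  obtain ⟨τ, σf, hτ, hτy, hj⟩ := exists_affine_diffeo hJ x
  have hτ0 : τ 0 = x := by simp [hτy]
  have hd := hτ.restrict hW
  have hgU := hg.mono (Set.inter_subset_right (s := Set.univ))
  have hωU := hω.mono (Set.inter_subset_right (s := Set.univ))
  have h0U : (0 : Pt n) ∈ Set.univ ∩ τ ⁻¹' W := ⟨Set.mem_univ _, by rwa [Set.mem_preimage, hτ0]⟩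
  have hpull : ∀ (t : Pt n → Fin (n + 1) → Fin (n + 1) → ℝ) a b, pullTensor n τ t 0 a b
      = (J * Matrix.of (t x) * J.transpose) a b := fun t a b => by
    rw [← pull_eq_mul]
    simp only [pullTensor, hj, hτ0]
  have h1 : ∀ a b, pullTensor n τ (T.T W g ω) 0 a b
      = pullTensor n τ (energyTensor n (m + 1) g ω) 0 a b := by
    intro a b
    rw [← T.natural_germ hd hd.open_src hW (hgU.pull hd) (hωU.pull hd) hg hω h0U h0U
      (by rwa [hτ0]) (Filter.Eventually.of_forall fun y => ⟨rfl, rfl⟩) a b,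
      T.eq_energyTensor_of_eq_minkM scale vanish divcond hd.open_src h0U (hgU.pull hd)
        (hωU.pull hd) (fun a b => by rw [hpull, hJdef, Matrix.transpose_transpose, hPg]; rfl),
      energyTensor_pull (x := x) (g := g) (ω := ω) hJ
        (fun a b => by simp only [pullTensor, hj, hτ0])
        (fun v => by simp only [pullForm, hj, hτ0])]
    simp only [pullTensor, hj, hτ0]
  have h2 : J * Matrix.of (T.T W g ω x) * J.transpose
      = J * Matrix.of (energyTensor n (m + 1) g ω x) * J.transpose := by
    ext a b
    rw [← hpull, ← hpull, h1]
  have hJt : IsUnit J.transpose.det := by rwa [Matrix.det_transpose]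
  have h3 := (Matrix.isUnit_iff_isUnit_det _).2 hJ |>.mul_left_cancel
    (((Matrix.isUnit_iff_isUnit_det _).2 hJt).mul_right_cancel h2)
  exact congrFun (congrFun h3 a) b

end Characterization

/-- characterization of the energy tensor of a `k`-form. -/
theorem statement1 (n k : ℕ) (hn : 1 ≤ n) (hk1 : 1 ≤ k) (hk2 : k ≤ n + 1)
    (T : NaturalTensor n k)
    (scale : ∀ W g ω, IsOpen W → IsMetricOn n W g → IsFormOn n k W ω →
      ∀ lam : ℝ, 0 < lam → ∀ x ∈ W, ∀ a b,
        T.T W (fun y c d => lam ^ 2 * g y c d) (fun y v => lam ^ (k - 1) * ω y v) x a b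
          = T.T W g ω x a b)
    (vanish : ∀ W g ω, IsOpen W → IsMetricOn n W g → IsFormOn n k W ω →
      ∀ x ∈ W, (∀ v, ω x v = 0) → ∀ a b, T.T W g ω x a b = 0)
    (divcond : ∀ W g ω, IsOpen W → IsMetricOn n W g → IsFormOn n k W ω →
      (∀ x ∈ W, ∀ u, dext n k ω x u = 0) →
      ∀ x ∈ W, ∀ b, divT n g (T.T W g ω) x b = - iCodiff n k g ω x b) :
    ∀ W g ω, IsOpen W → IsMetricOn n W g → IsFormOn n k W ω →
      ∀ x ∈ W, ∀ a b, T.T W g ω x a b = energyTensor n k g ω x a b := by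
  intro W g ω hW hg hω x hx a b
  obtain ⟨m, rfl⟩ := Nat.exists_eq_succ_of_ne_zero (Nat.one_le_iff_ne_zero.1 hk1)
  exact T.eq_energyTensor scale vanish divcond hW hg hω hx a b

end Paper
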